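/- arXiv:math/0112186 — 3 statements merged into one kernel-verified Lean document; each statement's English description precedes it below -/
import Mathlib

section
/- Let H : ℕ^k → ℕ be a numerical function. Then H is the Hilbert function of an ACM set of distinct points in ℙ^1 × ⋯ × ℙ^1 (k times) if and only if the first difference function ΔH satisfies: (i) ΔH(0,…,0) = 1; (ii) ΔH(i) ∈ {0,1} for all i > (0,…,0); (iii) if ΔH(i) = 0 then ΔH(j) = 0 for all j ≥ i (coordinatewise); and (iv) for each i ∈ {1,…,k} there exists an integer t_i such that ΔH(t_i e_i) = 0. -/
open MvPolynomial

noncomputable section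

namespace PaperMP

variable (K : Type) [Field K] [IsAlgClosed K] [CharZero K]
variable (k : ℕ) (n : Fin k → ℕ)

/-- Index type of the variables `x_{i,j}`, `1 ≤ i ≤ k`, `0 ≤ j ≤ n i`. -/
abbrev Sig := Σ i : Fin k, Fin (n i + 1)

/-- The `ℕ^k`-graded polynomial ring `R`. -/
abbrev MPRing := MvPolynomial (Sig k n) K

/-- The grading of `R`: `deg x_{i,j} = e_i`. -/
def wt : Sig k n → (Fin k → ℕ) := fun p => Pi.single p.1 1

/-- A point of `ℙ^{n_1} × ⋯ × ℙ^{n_k}`. -/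
abbrev MPPoint := ∀ i : Fin k, Projectivization K (Fin (n i + 1) → K)

/-- The affine cone over a point of multiprojective space. -/
def cone (P : MPPoint K k n) : Set (Sig k n → K) :=
  {x | ∀ i : Fin k, ∃ c : K, (fun j => x ⟨i, j⟩) = c • (P i).rep}

/-- Vanishing ideal of a set of points of affine space. -/
def vanishingIdeal (T : Set (Sig k n → K)) : Ideal (MPRing K k n) :=
  ⨅ x ∈ T, RingHom.ker (MvPolynomial.eval x)

/-- The (prime) ideal `I_P` of a point of multiprojective space. -/
def idealOfPoint (P : MPPoint K k n) : Ideal (MPRing K k n) :=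
  vanishingIdeal K k n (cone K k n P)

/-- The ideal `I_X` of a set of points of multiprojective space. -/
def idealOfSet (X : Set (MPPoint K k n)) : Ideal (MPRing K k n) :=
  ⨅ P ∈ X, idealOfPoint K k n P

/-- The Hilbert function of `R/I` in multidegree `d`. -/
def hilb (I : Ideal (MPRing K k n)) (d : Fin k → ℕ) : ℕ :=
  Module.finrank K ((weightedHomogeneousSubmodule K (wt k n) d).map
    (Ideal.Quotient.mkₐ K I).toLinearMap)

/-- The irrelevant maximal ideal `m = (x_{1,0},…,x_{k,n_k})`. -/
def maxIdeal : Ideal (MPRing K k n) :=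
  Ideal.span (Set.range (MvPolynomial.X : Sig k n → MPRing K k n))

/-- `L` is a regular sequence modulo `I`:  `(I,L) ⊆ m`, and each entry is a
non-zero divisor modulo `I` together with the previous entries. -/
def IsRegSeqMod (I : Ideal (MPRing K k n)) (L : List (MPRing K k n)) : Prop :=
  I ⊔ Ideal.span {f | f ∈ L} ≤ maxIdeal K k n ∧
  ∀ i : Fin L.length, ∀ G : MPRing K k n,
    L.get i * G ∈ I ⊔ Ideal.span {f | f ∈ L.take i} →
      G ∈ I ⊔ Ideal.span {f | f ∈ L.take i}

/-- `depth R/I = l`: `l` is the length of a maximal regular sequence modulo `I`. -/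
def hasDepth (I : Ideal (MPRing K k n)) (l : ℕ) : Prop :=
  IsGreatest {r : ℕ | ∃ L : List (MPRing K k n), L.length = r ∧ IsRegSeqMod K k n I L} l

/-- `X` is arithmetically Cohen–Macaulay: `depth R/I_X = K-dim R/I_X = k`. -/
def IsACM (X : Set (MPPoint K k n)) : Prop :=
  hasDepth K k n (idealOfSet K k n X) k

/-! ### The first difference function -/

/-- Extend `H : ℕ^k → ℕ` by zero outside ℕ^k. -/
def extNeg (H : (Fin k → ℕ) → ℕ) (j : Fin k → ℤ) : ℤ :=
  if ∀ i, 0 ≤ j i then H (fun i => (j i).toNat) else 0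

/-- The first difference function `ΔH` of a numerical function `H : ℕ^k → ℕ`. -/
def delta (H : (Fin k → ℕ) → ℕ) (d : Fin k → ℕ) : ℤ :=
  ∑ l : Fin k → Fin 2, (-1 : ℤ) ^ (∑ i, (l i : ℕ)) *
    extNeg k H (fun i => (d i : ℤ) - (l i : ℕ))

/-! ### The ring `S = k[x_{1,1},…,x_{k,n_k}]` -/

/-- Index type of the variables `x_{i,j}`, `1 ≤ i ≤ k`, `1 ≤ j ≤ n i`. -/
abbrev SigS := Σ i : Fin k, Fin (n i)

/-- The `ℕ^k`-graded polynomial ring `S`. -/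
abbrev SRing := MvPolynomial (SigS k n) K

/-- The grading of `S`: `deg x_{i,j} = e_i`. -/
def wtS : SigS k n → (Fin k → ℕ) := fun p => Pi.single p.1 1

/-- The Hilbert function of `S/J` in multidegree `d`. -/
def hilbS (J : Ideal (SRing K k n)) (d : Fin k → ℕ) : ℕ :=
  Module.finrank K ((weightedHomogeneousSubmodule K (wtS k n) d).map
    (Ideal.Quotient.mkₐ K J).toLinearMap)

/-- `J` is an `ℕ^k`-homogeneous ideal of `S`. -/
def IsHomogIdealS (J : Ideal (SRing K k n)) : Prop :=
  ∀ f ∈ J, ∀ d : Fin k → ℕ, weightedHomogeneousComponent (wtS k n) d f ∈ J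

/-- `J` is an artinian ideal of `S`: `√J = (x_{1,1},…,x_{k,n_k})`. -/
def IsArtinianIdealS (J : Ideal (SRing K k n)) : Prop :=
  J.radical = Ideal.span (Set.range (MvPolynomial.X : SigS k n → SRing K k n))

/-! ### The ring `k[x_1,…,x_k]`, with `deg x_i = e_i` -/

abbrev TRing := MvPolynomial (Fin k) K

/-- The grading: `deg x_i = e_i`. -/
def wtT : Fin k → (Fin k → ℕ) := fun i => Pi.single i 1

/-- The Hilbert function of `k[x_1,…,x_k]/I` in multidegree `d`. -/
def hilbT (I : Ideal (TRing K k)) (d : Fin k → ℕ) : ℕ :=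
  Module.finrank K ((weightedHomogeneousSubmodule K (wtT k) d).map
    (Ideal.Quotient.mkₐ K I).toLinearMap)

/-- `I` is an `ℕ^k`-homogeneous ideal of `k[x_1,…,x_k]`. -/
def IsHomogIdealT (I : Ideal (TRing K k)) : Prop :=
  ∀ f ∈ I, ∀ d : Fin k → ℕ, weightedHomogeneousComponent (wtT k) d f ∈ I

/-- `I` is an artinian ideal of `k[x_1,…,x_k]`: `√I = (x_1,…,x_k)`. -/
def IsArtinianIdealT (I : Ideal (TRing K k)) : Prop :=
  I.radical = Ideal.span (Set.range (MvPolynomial.X : Fin k → TRing K k))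

/-! ### Lifting monomial ideals -/

/-- The lift `m̄ = ∏_{i,j} ∏_{l=1}^{a_{i,j}} (x_{i,j} - (l-1) x_{i,0})` of the monomial
of `S` with exponent vector `b`, via the lifting matrix `𝒜`. -/
def liftMonomial (b : SigS k n →₀ ℕ) : MPRing K k n :=
  ∏ p ∈ b.support, ∏ l ∈ Finset.range (b p),
    (MvPolynomial.X (⟨p.1, p.2.succ⟩ : Sig k n) - (l : MPRing K k n) * MvPolynomial.X ⟨p.1, 0⟩)

/-- `J` is a monomial ideal of `S`. -/
def IsMonomialIdeal (J : Ideal (SRing K k n)) : Prop :=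
  ∃ A : Set (SigS k n →₀ ℕ), J = Ideal.span ((fun b => (monomial b (1 : K) : SRing K k n)) '' A)

/-- The exponent vectors of the minimal monomial generators of a monomial ideal `J ⊆ S`. -/
def minGens (J : Ideal (SRing K k n)) : Set (SigS k n →₀ ℕ) :=
  {b | (monomial b (1 : K) : SRing K k n) ∈ J ∧
    ∀ b' : SigS k n →₀ ℕ, b' ≤ b → b' ≠ b → (monomial b' (1 : K) : SRing K k n) ∉ J}

/-- The lift to `R` of a monomial ideal `J ⊆ S`, generated by the lifts of the
minimal monomial generators of `J`. -/
def liftIdeal (J : Ideal (SRing K k n)) : Ideal (MPRing K k n) :=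
  Ideal.span (liftMonomial K k n '' minGens K k n J)

/-- The projection `R → S ≅ R/(x_{1,0},…,x_{k,0})` sending `x_{i,0} ↦ 0` and
`x_{i,j} ↦ x_{i,j}` for `j ≥ 1`. -/
def projToS : MPRing K k n →ₐ[K] SRing K k n :=
  aeval (fun p : Sig k n =>
    if h : p.2 = 0 then 0 else MvPolynomial.X (⟨p.1, p.2.pred h⟩ : SigS k n))

/-- The point `[1:b_{i,1}:⋯:b_{i,n_i}] × ⋯` of multiprojective space associated to the
exponent vector `b` of a monomial of `S`. -/
def monToPoint (b : SigS k n →₀ ℕ) : MPPoint K k n := fun i =>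
  Projectivization.mk K
    (fun j : Fin (n i + 1) => if h : j = 0 then 1 else ((b ⟨i, j.pred h⟩ : ℕ) : K))
    (fun hc => by simpa using congrFun hc 0)

/-! ### Partitions -/

/-- `lam` is a partition: positive non-increasing entries. -/
def IsPartition {t : ℕ} (lam : Fin t → ℕ) : Prop :=
  (∀ j, 0 < lam j) ∧ Antitone lam

/-- `lam` is a partition of `s`. -/
def IsPartitionOf (s : ℕ) {t : ℕ} (lam : Fin t → ℕ) : Prop :=
  IsPartition lam ∧ ∑ j, lam j = s

/-- The `(i+1)`-st entry `λ*_{i+1} = #{j : λ_j ≥ i+1}` of the conjugate partition. -/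
def conjEntry {t : ℕ} (lam : Fin t → ℕ) (i : ℕ) : ℕ :=
  (Finset.univ.filter fun j : Fin t => i + 1 ≤ lam j).card

/-- `β` is the conjugate partition `α*` of `α`. -/
def IsConjugateOf {t m : ℕ} (α : Fin t → ℕ) (β : Fin m → ℕ) : Prop :=
  (∀ i : Fin m, β i = conjEntry α i) ∧ ∀ i : ℕ, m ≤ i → conjEntry α i = 0

/-! ### `ℙ^1 × ℙ^1` -/

/-- A point of `ℙ^1`. -/
abbrev Proj1 := Projectivization K (Fin 2 → K)

/-- A point of `ℙ^1 × ℙ^1`. -/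
abbrev Pt2 := MPPoint K 2 (fun _ => 1)

/-- The coordinate ring of `ℙ^1 × ℙ^1`. -/
abbrev R2 := MPRing K 2 (fun _ => 1)

/-- `P` enumerates the distinct first coordinates of `X` and `α` lists the sizes of the
corresponding fibers, in non-increasing order; so `α = α_X`. -/
def IsAlphaLabel (X : Set (Pt2 K)) {t : ℕ} (P : Fin t → Proj1 K) (α : Fin t → ℕ) : Prop :=
  Function.Injective P ∧ (Set.range P = (fun Z : Pt2 K => Z 0) '' X) ∧
  (∀ i, α i = Set.ncard {Z | Z ∈ X ∧ Z 0 = P i}) ∧ Antitone α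

/-- `Q` enumerates the distinct second coordinates of `X` and `β` lists the sizes of the
corresponding fibers, in non-increasing order; so `β = β_X`. -/
def IsBetaLabel (X : Set (Pt2 K)) {r : ℕ} (Q : Fin r → Proj1 K) (β : Fin r → ℕ) : Prop :=
  Function.Injective Q ∧ (Set.range Q = (fun Z : Pt2 K => Z 1) '' X) ∧
  (∀ i, β i = Set.ncard {Z | Z ∈ X ∧ Z 1 = Q i}) ∧ Antitone β

/-- `α = α_X`. -/
def IsAlphaPartition (X : Set (Pt2 K)) {t : ℕ} (α : Fin t → ℕ) : Prop :=
  ∃ P : Fin t → Proj1 K, IsAlphaLabel K X P α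

/-- `β = β_X`. -/
def IsBetaPartition (X : Set (Pt2 K)) {r : ℕ} (β : Fin r → ℕ) : Prop :=
  ∃ Q : Fin r → Proj1 K, IsBetaLabel K X Q β

/-- `F` is "the" form of degree `(1,0)` vanishing at all points of `ℙ^1 × ℙ^1` whose
first coordinate is `P`. -/
def IsForm1Of (P : Proj1 K) (F : R2 K) : Prop :=
  IsWeightedHomogeneous (wt 2 (fun _ => 1)) F (Pi.single 0 1) ∧ F ≠ 0 ∧
  ∀ x : Sig 2 (fun _ => 1) → K,
    (∃ c : K, (fun j : Fin 2 => x ⟨0, j⟩) = c • P.rep) → MvPolynomial.eval x F = 0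

/-- `F` is "the" form of degree `(0,1)` vanishing at all points of `ℙ^1 × ℙ^1` whose
second coordinate is `P`. -/
def IsForm2Of (P : Proj1 K) (F : R2 K) : Prop :=
  IsWeightedHomogeneous (wt 2 (fun _ => 1)) F (Pi.single 1 1) ∧ F ≠ 0 ∧
  ∀ x : Sig 2 (fun _ => 1) → K,
    (∃ c : K, (fun j : Fin 2 => x ⟨1, j⟩) = c • P.rep) → MvPolynomial.eval x F = 0

end PaperMP

namespace PaperMP

section Depth

variable {R : Type*} [CommRing R]

/-- `x` is a non-zero divisor modulo `J`. -/
def RegMod (J : Ideal R) (x : R) : Prop := ∀ g, x * g ∈ J → g ∈ J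

/-- There is a regular sequence modulo `J` of length `r` with entries in `m`. -/
def DepthGE (m : Ideal R) : ℕ → Ideal R → Prop
  | 0, _ => True
  | r + 1, J => ∃ x ∈ m, RegMod J x ∧ DepthGE m r (J ⊔ Ideal.span {x})

lemma mem_sup_span_singleton {J : Ideal R} {x a : R} :
    a ∈ J ⊔ Ideal.span {x} ↔ ∃ j ∈ J, ∃ b, a = j + x * b := by
  rw [Submodule.mem_sup]
  constructor
  · rintro ⟨j, hj, z, hz, rfl⟩
    obtain ⟨b, rfl⟩ := Ideal.mem_span_singleton'.1 hz
    exact ⟨j, hj, b, by ring⟩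
  · rintro ⟨j, hj, b, rfl⟩
    exact ⟨j, hj, x * b, Ideal.mul_mem_right _ _ (Ideal.mem_span_singleton_self x), rfl⟩

lemma RegMod.swap {J : Ideal R} {x y : R} (hx : RegMod J x)
    (hy : RegMod (J ⊔ Ideal.span {x}) y) : RegMod (J ⊔ Ideal.span {y}) x := by
  intro a ha
  obtain ⟨j, hj, b, hb⟩ := mem_sup_span_singleton.1 ha
  have h1 : b ∈ J ⊔ Ideal.span {x} := hy b
    (mem_sup_span_singleton.2 ⟨-j, J.neg_mem hj, a, by rw [hb]; ring⟩)
  obtain ⟨j', hj', c, rfl⟩ := mem_sup_span_singleton.1 h1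
  have h2 : a - y * c ∈ J := hx _ <| by
    have : x * (a - y * c) = j + y * j' := by linear_combination hb
    rw [this]
    exact J.add_mem hj (J.mul_mem_left _ hj')
  exact mem_sup_span_singleton.2 ⟨a - y * c, h2, c, by ring⟩

lemma exists_regMod [IsNoetherianRing R] (m : Ideal R) (s : Finset (Ideal R))
    (hs : ∀ J ∈ s, ∀ u, (∀ x ∈ m, x * u ∈ J) → u ∈ J) :
    ∃ y ∈ m, ∀ J ∈ s, RegMod J y := by
  classical
  by_contra! hcon
  let T : Finset (Ideal R) := s.biUnion fun J => (associatedPrimes.finite R (R ⧸ J)).toFinset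
  have hT : ∀ p ∈ T, ∃ J ∈ s, p ∈ associatedPrimes R (R ⧸ J) := by
    intro p hp
    simpa [T] using hp
  have hsub : (m : Set R) ⊆ ⋃ p ∈ (↑T : Set (Ideal R)), (id p : Ideal R) := by
    intro y hy
    obtain ⟨J, hJ, hreg⟩ := hcon y hy
    simp only [RegMod, not_forall] at hreg
    obtain ⟨g, hg, hgJ⟩ := hreg
    have : y ∈ ⋃ p ∈ associatedPrimes R (R ⧸ J), (p : Set R) := by
      rw [biUnion_associatedPrimes_eq_zero_divisors]
      refine ⟨Ideal.Quotient.mk J g, by rwa [Ne, Ideal.Quotient.eq_zero_iff_mem], ?_⟩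
      rw [← Ideal.Quotient.mk_eq_mk, ← Submodule.Quotient.mk_smul, Ideal.Quotient.mk_eq_mk,
        Ideal.Quotient.eq_zero_iff_mem]
      exact hg
    simp only [Set.mem_iUnion] at this ⊢
    obtain ⟨p, hp, hyp⟩ := this
    exact ⟨p, by simpa [T] using ⟨J, hJ, hp⟩, hyp⟩
  obtain ⟨p, hpT, hmp⟩ := (Ideal.subset_union_prime (f := id) ⊥ ⊥ (fun p hp _ _ => by
    obtain ⟨J, -, h⟩ := hT p hp
    exact IsAssociatedPrime.isPrime h)).1 hsub
  obtain ⟨J, hJ, hp⟩ := hT p hpT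
  obtain ⟨hprime, x, hx⟩ := isAssociatedPrime_iff.1 hp
  obtain ⟨u, rfl⟩ := Ideal.Quotient.mk_surjective x
  have hiff : ∀ z, z ∈ p ↔ z * u ∈ J := by
    intro z
    rw [hx, Submodule.mem_colon_singleton, Submodule.mem_bot, ← Ideal.Quotient.mk_eq_mk,
      ← Submodule.Quotient.mk_smul, Ideal.Quotient.mk_eq_mk, Ideal.Quotient.eq_zero_iff_mem]
    rfl
  have hu : u ∈ J := hs J hJ u fun z hz => (hiff z).1 (hmp hz)
  exact hprime.ne_top ((Ideal.eq_top_iff_one _).2 ((hiff 1).2 (by simpa using hu)))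

/-- Dividing by a regular element lowers the depth by at most one. -/
lemma DepthGE.sup_span [IsNoetherianRing R] {m : Ideal R} : ∀ {r : ℕ} {J : Ideal R} {x : R},
    DepthGE m (r + 1) J → x ∈ m → RegMod J x → DepthGE m r (J ⊔ Ideal.span {x}) := by
  classical
  intro r
  induction r with
  | zero => intros; trivial
  | succ r ih =>
    intro J x hD hxm hx
    obtain ⟨f, hfm, hf, hD'⟩ := hD
    obtain ⟨f₂, hf₂m, hf₂, -⟩ := id hD'
    obtain ⟨y, hym, hy⟩ := exists_regMod m {J ⊔ Ideal.span {f}, J ⊔ Ideal.span {x}} (by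
      intro J' hJ' u hu
      simp only [Finset.mem_insert, Finset.mem_singleton] at hJ'
      rcases hJ' with rfl | rfl
      · exact hf₂ u (hu f₂ hf₂m)
      · obtain ⟨j, hj, v, hv⟩ := mem_sup_span_singleton.1 (hu f hfm)
        have hvf : v ∈ J ⊔ Ideal.span {f} := by
          refine hf₂ v ?_
          obtain ⟨j', hj', w, hw⟩ := mem_sup_span_singleton.1 (hu f₂ hf₂m)
          have : f₂ * v - f * w ∈ J := hx _ <| by
            have : x * (f₂ * v - f * w) = f * j' - f₂ * j := by
              linear_combination f * hw - f₂ * hv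
            rw [this]
            exact J.sub_mem (J.mul_mem_left _ hj') (J.mul_mem_left _ hj)
          exact mem_sup_span_singleton.2 ⟨_, this, w, by ring⟩
        obtain ⟨j'', hj'', w, rfl⟩ := mem_sup_span_singleton.1 hvf
        have : u - x * w ∈ J := hf _ <| by
          have : f * (u - x * w) = j + x * j'' := by linear_combination hv
          rw [this]
          exact J.add_mem hj (J.mul_mem_left _ hj'')
        exact mem_sup_span_singleton.2 ⟨_, this, w, by ring⟩)
    have hyf := hy (J ⊔ Ideal.span {f}) (by simp)
    have hyx := hy (J ⊔ Ideal.span {x}) (by simp)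
    have h1 : DepthGE m (r + 1) (J ⊔ Ideal.span {y}) :=
      ⟨f, hfm, hf.swap hyf, by rw [sup_right_comm]; exact ih hD' hym hyf⟩
    exact ⟨y, hym, hyx, by rw [sup_right_comm]; exact ih h1 hxm (hx.swap hyx)⟩

lemma mem_of_smul_le [IsNoetherianRing R] {m J N p : Ideal R} [m.IsPrime] (hpm : p ≤ m)
    {u f s : R} (hu : u ∈ N) (hup : ∀ z, z * u ∈ J → z ∈ p) (hfm : f ∈ m)
    (hs : ∀ v ∈ N, ∃ w ∈ N, s * v - f * w ∈ J) : s ∈ m := by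
  let N' : Submodule R (R ⧸ J) := Submodule.map J.mkQ N
  let φ : Module.End R N' := LinearMap.lsmul R N' s
  have hφ : LinearMap.range φ ≤ Ideal.span {f} • ⊤ := by
    rintro _ ⟨⟨_, v, hv, rfl⟩, rfl⟩
    obtain ⟨w, hw, hvw⟩ := hs v hv
    have : φ ⟨J.mkQ v, v, hv, rfl⟩ = f • (⟨J.mkQ w, w, hw, rfl⟩ : N') := by
      apply Subtype.ext
      change s • J.mkQ v = f • J.mkQ w
      rw [← sub_eq_zero, ← map_smul, ← map_smul, ← map_sub, Submodule.mkQ_apply,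
        Submodule.Quotient.mk_eq_zero]
      exact hvw
    rw [this]
    exact Submodule.smul_mem_smul (Ideal.mem_span_singleton_self f) trivial
  obtain ⟨q, hq, -, hcoef, hq0⟩ :=
    LinearMap.exists_monic_and_natDegree_eq_and_coeff_mem_pow_and_aeval_eq_zero R φ _ hφ
  have haev : Polynomial.aeval φ q = LinearMap.lsmul R N' (q.eval s) := by
    have : φ = algebraMap R (Module.End R N') s := rfl
    rw [this, Polynomial.aeval_algebraMap_apply]
    simp [Polynomial.aeval_def, Polynomial.eval₂_eq_eval_map]
    rfl
  have h0 : q.eval s * u ∈ J := by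
    rw [haev] at hq0
    have := congrArg Subtype.val (LinearMap.congr_fun hq0 ⟨J.mkQ u, u, hu, rfl⟩)
    change q.eval s • J.mkQ u = 0 at this
    rw [← map_smul, Submodule.mkQ_apply, Submodule.Quotient.mk_eq_zero] at this
    exact this
  have h1 : q.eval s ∈ m := hpm (hup _ h0)
  rw [Polynomial.eval_eq_sum_range, Finset.sum_range_succ, hq.coeff_natDegree, one_mul] at h1
  have h2 : ∑ i ∈ Finset.range q.natDegree, q.coeff i * s ^ i ∈ m := by
    refine m.sum_mem fun i hi => m.mul_mem_right _ ?_
    have hle : Ideal.span {f} ^ (q.natDegree - i) ≤ m :=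
      (Ideal.pow_le_self (by have := Finset.mem_range.1 hi; omega)).trans
        ((Ideal.span_singleton_le_iff_mem _).2 hfm)
    exact hle (hcoef i)
  exact Ideal.IsPrime.mem_of_pow_mem ‹_› _ ((m.add_mem_iff_right h2).1 h1)

/-- Depth is bounded by the dimension of the support of any cyclic submodule. -/
lemma DepthGE.exists_prime [IsNoetherianRing R] {m : Ideal R} [hm : m.IsPrime] :
    ∀ {r : ℕ} {J : Ideal R} {u : R}, DepthGE m r J → (∀ s, s * u ∈ J → s ∈ m) →
    ∃ p : Ideal R, p.IsPrime ∧ (∀ s, s * u ∈ J → s ∈ p) ∧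
      (r : WithBot ℕ∞) ≤ ringKrullDim (R ⧸ p) := by
  intro r
  induction r with
  | zero =>
    intro J u _ hu
    refine ⟨m, hm, hu, ?_⟩
    simpa using ringKrullDim_nonneg_of_nontrivial
  | succ r ih =>
    intro J u hD hu
    obtain ⟨f, hfm, hf, hD'⟩ := hD
    obtain ⟨p, hp, hpm⟩ := Ideal.exists_minimalPrimes_le (I := Submodule.colon J {u}) (J := m)
      (fun s hs => hu s (Submodule.mem_colon_singleton.1 hs))
    have hprime : p.IsPrime := hp.1.1
    obtain ⟨u', hu'⟩ := Submodule.exists_eq_colon_of_mem_minimalPrimes hp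
    have hiff : ∀ z, z ∈ p ↔ z * u' ∈ J := fun z => by
      rw [hu', Submodule.mem_colon_singleton]; rfl
    let N : Ideal R := Submodule.colon J (p : Set R)
    have hN : ∀ v, v ∈ N ↔ ∀ a ∈ p, v * a ∈ J := fun v => Submodule.mem_colon
    have hfp : f ∉ p := fun h => hprime.ne_top
      ((Ideal.eq_top_iff_one _).2 ((hiff 1).2 (by simpa using hf u' ((hiff f).1 h))))
    obtain ⟨v, hvN, hv⟩ : ∃ v ∈ N, ∀ s, s * v ∈ J ⊔ Ideal.span {f} → s ∈ m := by
      by_contra! hcon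
      have key : ∀ N' : Ideal R, N'.FG → N' ≤ N →
          ∃ s, s ∉ m ∧ ∀ v ∈ N', s * v ∈ J ⊔ Ideal.span {f} := by
        intro N' hfg
        induction N', hfg using Submodule.fg_induction with
        | singleton x =>
          intro hx
          obtain ⟨s, hs, hsm⟩ := hcon x (hx (Submodule.mem_span_singleton_self x))
          refine ⟨s, hsm, fun v hv => ?_⟩
          obtain ⟨a, rfl⟩ := Submodule.mem_span_singleton.1 hv
          rw [smul_eq_mul, mul_left_comm]
          exact Ideal.mul_mem_left _ _ hs
        | sup N₁ N₂ _ _ h₁ h₂ =>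
          intro hle
          obtain ⟨s₁, hs₁, h₁⟩ := h₁ (le_sup_left.trans hle)
          obtain ⟨s₂, hs₂, h₂⟩ := h₂ (le_sup_right.trans hle)
          refine ⟨s₁ * s₂, fun h => (hm.mem_or_mem h).elim hs₁ hs₂, fun v hv => ?_⟩
          obtain ⟨a, ha, b, hb, rfl⟩ := Submodule.mem_sup.1 hv
          have : s₁ * s₂ * (a + b) = s₂ * (s₁ * a) + s₁ * (s₂ * b) := by ring
          rw [this]
          exact Ideal.add_mem _ (Ideal.mul_mem_left _ _ (h₁ a ha)) (Ideal.mul_mem_left _ _ (h₂ b hb))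
      obtain ⟨s, hsm, hs⟩ := key N (IsNoetherian.noetherian N) le_rfl
      refine hsm (mem_of_smul_le (J := J) (N := N) hpm (u := u') (f := f) ?_
        (fun z hz => (hiff z).2 hz) hfm ?_)
      · exact (hN u').2 fun a ha => by rw [mul_comm]; exact (hiff a).1 ha
      · intro v hv
        obtain ⟨j, hj, w, hw⟩ := mem_sup_span_singleton.1 (hs v hv)
        refine ⟨w, (hN w).2 fun a ha => hf _ ?_, by rw [hw]; simpa using hj⟩
        have : f * (w * a) = s * (v * a) - a * j := by linear_combination -a * hw
        rw [this]
        exact J.sub_mem (J.mul_mem_left _ ((hN v).1 hv a ha)) (J.mul_mem_left _ hj)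
    obtain ⟨q, hq, hvq, hdim⟩ := ih hD' hv
    have hpq : p ≤ q := fun a ha => hvq a <| by
      rw [mul_comm]
      exact Ideal.mem_sup_left ((hN v).1 hvN a ha)
    have hfq : f ∈ q := hvq f (mem_sup_span_singleton.2 ⟨0, J.zero_mem, v, by ring⟩)
    refine ⟨p, hprime, fun s hs => hp.1.2 (Submodule.mem_colon_singleton.2 hs), ?_⟩
    have := ringKrullDim_succ_le_of_surjective (Ideal.Quotient.factor hpq)
      (Ideal.Quotient.factor_surjective hpq) (r := Ideal.Quotient.mk p f)
      (mem_nonZeroDivisors_of_ne_zero (by rwa [Ne, Ideal.Quotient.eq_zero_iff_mem]))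
      (by rw [Ideal.Quotient.factor_mk, Ideal.Quotient.eq_zero_iff_mem]; exact hfq)
    refine le_trans ?_ this
    push_cast
    gcongr

end Depth

section Graded

variable {K : Type} [Field K] {k : ℕ} {n : Fin k → ℕ}

attribute [local instance] MvPolynomial.weightedGradedAlgebra

lemma mem_maxIdeal_iff {f : MPRing K k n} : f ∈ maxIdeal K k n ↔ coeff 0 f = 0 := by
  have := mem_pow_idealOfVars_iff' (R := K) 1 f
  rw [pow_one] at this
  change f ∈ idealOfVars _ _ ↔ _
  rw [this]
  refine ⟨fun h => h 0 (by simp), fun h x hx => ?_⟩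
  rw [Nat.lt_one_iff, Finsupp.degree_eq_zero_iff] at hx
  rwa [hx]

instance isPrime_maxIdeal : (maxIdeal K k n).IsPrime := by
  have : maxIdeal K k n = RingHom.ker (constantCoeff (R := K) (σ := Sig k n)) := by
    ext f
    rw [mem_maxIdeal_iff, RingHom.mem_ker, constantCoeff_eq]
  rw [this]
  exact RingHom.ker_isPrime _

/-- `J` is `ℕ^k`-homogeneous. -/
abbrev IsHomogR (J : Ideal (MPRing K k n)) : Prop :=
  J.IsHomogeneous (weightedHomogeneousSubmodule K (wt k n))

lemma decompose_eq (f : MPRing K k n) (d : Fin k → ℕ) :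
    (DirectSum.decompose (weightedHomogeneousSubmodule K (wt k n)) f d : MPRing K k n) =
      weightedHomogeneousComponent (wt k n) d f :=
  weightedDecomposition.decompose'_apply K (wt k n) f d

lemma wt_ne_zero (p : Sig k n) : wt k n p ≠ 0 := by
  intro h
  simpa [wt] using congrFun h p.1

lemma weight_wt_apply (s : Sig k n →₀ ℕ) (i : Fin k) :
    Finsupp.weight (wt k n) s i = ∑ j, s ⟨i, j⟩ := by
  rw [Finsupp.weight_eq_sum, Finset.sum_apply, Fintype.sum_sigma,
    Finset.sum_eq_single i]
  · simp [wt]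
  · intro b _ hb
    simp [wt, hb.symm]
  · simp

lemma le_weight_wt (s : Sig k n →₀ ℕ) (p : Sig k n) : s p ≤ Finsupp.weight (wt k n) s p.1 := by
  rw [weight_wt_apply]
  exact Finset.single_le_sum (f := fun j => s ⟨p.1, j⟩) (fun _ _ => Nat.zero_le _)
    (Finset.mem_univ p.2)

instance finite_homog (d : Fin k → ℕ) :
    Module.Finite K (weightedHomogeneousSubmodule K (wt k n) d) := by
  rw [weightedHomogeneousSubmodule_eq_finsupp_supported]
  have : ({s | Finsupp.weight (wt k n) s = d} : Set (Sig k n →₀ ℕ)).Finite := by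
    refine Set.Finite.subset (Set.finite_Iic (Finsupp.equivFunOnFinite.symm fun p => d p.1)) ?_
    rintro s rfl
    exact fun p => le_weight_wt s p
  have := this.to_subtype
  exact Module.Finite.of_basis (basisRestrictSupport K {s | Finsupp.weight (wt k n) s = d})

/-- Elements outside the irrelevant ideal are non-zero divisors modulo homogeneous ideals. -/
lemma IsHomogR.mem_of_mul_mem {J : Ideal (MPRing K k n)} (hJ : IsHomogR J) {s g : MPRing K k n}
    (hs : s ∉ maxIdeal K k n) (hsg : s * g ∈ J) : g ∈ J := by
  rw [mem_iff_weightedHomogeneousComponent_mem K (wt k n) hJ]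
  rw [mem_maxIdeal_iff] at hs
  classical
  intro d
  induction d using WellFoundedLT.induction with
  | ind d ih =>
  have h1 := (mem_iff_weightedHomogeneousComponent_mem K (wt k n) hJ _).1 hsg d
  have h2 : weightedHomogeneousComponent (wt k n) d (s * g) =
      ∑ᶠ e, weightedHomogeneousComponent (wt k n) d
        (weightedHomogeneousComponent (wt k n) e s * g) := by
    conv_lhs => rw [← sum_weightedHomogeneousComponent (wt k n) s]
    rw [finsum_eq_sum _ (weightedHomogeneousComponent_finsupp s), Finset.sum_mul, map_sum,
      finsum_eq_sum_of_support_subset]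
    intro e he
    rw [Function.mem_support] at he
    refine (Set.Finite.mem_toFinset _).2 ?_
    rw [Function.mem_support]
    intro h0
    exact he (by rw [h0, zero_mul, map_zero])
  have hcomp : ∀ e, weightedHomogeneousComponent (wt k n) d
        (weightedHomogeneousComponent (wt k n) e s * g) =
      if e ≤ d then weightedHomogeneousComponent (wt k n) e s *
        weightedHomogeneousComponent (wt k n) (d - e) g else 0 := by
    intro e
    rw [← decompose_eq, DirectSum.coe_decompose_mul_of_left_mem _ _
      (weightedHomogeneousComponent_mem (wt k n) s e), decompose_eq]
  by_contra hd
  have hfin : (Function.support fun e => weightedHomogeneousComponent (wt k n) d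
      (weightedHomogeneousComponent (wt k n) e s * g)).Finite := by
    refine Set.Finite.subset (weightedHomogeneousComponent_finsupp (w := wt k n) s) fun e he => ?_
    simp only [Function.mem_support] at he ⊢
    intro h0
    exact he (by rw [h0, zero_mul, map_zero])
  rw [h2, finsum_eq_sum_of_support_subset (s := insert 0 hfin.toFinset) _ (by
    intro e he; simpa using Or.inr he)] at h1
  rw [← Finset.add_sum_erase _ _ (Finset.mem_insert_self _ _)] at h1
  have h3 := (J.add_mem_iff_left (J.sum_mem fun e he => ?_)).1 h1
  · rw [hcomp, if_pos (zero_le), weightedHomogeneousComponent_zero s wt_ne_zero, tsub_zero] at h3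
    refine hd ?_
    have := J.mul_mem_left (C (coeff 0 s)⁻¹) h3
    rwa [← mul_assoc, ← C_mul, inv_mul_cancel₀ hs, C_1, one_mul] at this
  · rw [hcomp]
    split_ifs with hed
    · refine J.mul_mem_left _ (ih _ ?_)
      have hne := Finset.ne_of_mem_erase he
      refine lt_of_le_of_ne tsub_le_self fun h => hne ?_
      ext i
      have h1 : d i - e i = d i := congrFun h i
      have h2 : e i ≤ d i := hed i
      change e i = 0
      omega
    · exact J.zero_mem

lemma IsHomogR.sup_span {J : Ideal (MPRing K k n)} (hJ : IsHomogR J) {x : MPRing K k n}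
    {e : Fin k → ℕ} (hx : IsWeightedHomogeneous (wt k n) x e) : IsHomogR (J ⊔ Ideal.span {x}) := by
  refine Ideal.IsHomogeneous.sup hJ (Ideal.homogeneous_span _ _ ?_)
  rintro _ rfl
  exact ⟨e, hx⟩

/-- The graded piece of `R/J`. -/
abbrev piece (J : Ideal (MPRing K k n)) (d : Fin k → ℕ) : Submodule K (MPRing K k n ⧸ J) :=
  (weightedHomogeneousSubmodule K (wt k n) d).map (Ideal.Quotient.mkₐ K J).toLinearMap

lemma mem_piece {J : Ideal (MPRing K k n)} {d : Fin k → ℕ} {a : MPRing K k n ⧸ J} :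
    a ∈ piece J d ↔ ∃ f, IsWeightedHomogeneous (wt k n) f d ∧ Ideal.Quotient.mk J f = a := Iff.rfl

lemma finrank_map_eq_of_injective {V W : Type} [AddCommGroup V] [Module K V] [AddCommGroup W]
    [Module K W] {f : V →ₗ[K] W} (hf : Function.Injective f) (p : Submodule K V) :
    Module.finrank K (p.map f) = Module.finrank K p :=
  (LinearEquiv.finrank_eq (Submodule.equivMapOfInjective f hf p)).symm

lemma hilb_exact {J J' : Ideal (MPRing K k n)} (hle : J ≤ J') (d : Fin k → ℕ)
    (W : Submodule K (MPRing K k n ⧸ J))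
    (hW : ∀ a, a ∈ W ↔ ∃ f, IsWeightedHomogeneous (wt k n) f d ∧ f ∈ J' ∧
      Ideal.Quotient.mk J f = a) :
    hilb K k n J d = hilb K k n J' d + Module.finrank K W := by
  let ρ : (MPRing K k n ⧸ J) →ₗ[K] (MPRing K k n ⧸ J') :=
    (Ideal.Quotient.factorₐ K hle).toLinearMap
  have h := LinearMap.finrank_range_add_finrank_ker (ρ.domRestrict (piece J d))
  have h1 : LinearMap.range (ρ.domRestrict (piece J d)) = piece J' d := by
    ext a
    constructor
    · rintro ⟨⟨_, f, hf, rfl⟩, rfl⟩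
      exact ⟨f, hf, rfl⟩
    · rintro ⟨f, hf, rfl⟩
      exact ⟨⟨_, f, hf, rfl⟩, rfl⟩
  have h2 : (LinearMap.ker (ρ.domRestrict (piece J d))).map (piece J d).subtype = W := by
    ext a
    rw [hW]
    constructor
    · rintro ⟨⟨_, f, hf, rfl⟩, hk, rfl⟩
      refine ⟨f, hf, ?_, rfl⟩
      rw [SetLike.mem_coe, LinearMap.mem_ker] at hk
      exact Ideal.Quotient.eq_zero_iff_mem.1 hk
    · rintro ⟨f, hf, hfJ, rfl⟩
      exact ⟨⟨_, f, hf, rfl⟩, LinearMap.mem_ker.2 (Ideal.Quotient.eq_zero_iff_mem.2 hfJ), rfl⟩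
  rw [← h2, finrank_map_eq_of_injective Subtype.val_injective]
  rw [h1] at h
  exact h.symm

lemma hilb_of_zero {J : Ideal (MPRing K k n)} (hJ : IsHomogR J) {x : MPRing K k n} {i : Fin k}
    (hx : IsWeightedHomogeneous (wt k n) x (Pi.single i 1))
    {d : Fin k → ℕ} (hd : d i = 0) :
    hilb K k n J d = hilb K k n (J ⊔ Ideal.span {x}) d := by
  rw [hilb_exact (J' := J ⊔ Ideal.span {x}) le_sup_left d ⊥, finrank_bot, add_zero]
  intro a
  rw [Submodule.mem_bot]
  constructor
  · rintro rfl
    exact ⟨0, isWeightedHomogeneous_zero _ _ _, zero_mem _, map_zero _⟩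
  · rintro ⟨f, hf, hfJ, rfl⟩
    obtain ⟨j, hj, b, rfl⟩ := mem_sup_span_singleton.1 hfJ
    rw [Ideal.Quotient.eq_zero_iff_mem]
    have h1 := hf.weightedHomogeneousComponent_same
    have h2 : weightedHomogeneousComponent (wt k n) d (x * b) = 0 := by
      rw [← decompose_eq, DirectSum.coe_decompose_mul_of_left_mem_of_not_le _ hx]
      intro hle
      have := hle i
      simp [hd] at this
    rw [← h1, map_add, h2, add_zero]
    exact weightedHomogeneousComponent_mem_of_mem K (wt k n) hJ hj d

lemma hilb_succ {J : Ideal (MPRing K k n)} (hJ : IsHomogR J) {x : MPRing K k n}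
    (hreg : RegMod J x) {e : Fin k → ℕ}
    (hx : IsWeightedHomogeneous (wt k n) x e) (d : Fin k → ℕ) :
    hilb K k n J (e + d) = hilb K k n (J ⊔ Ideal.span {x}) (e + d) + hilb K k n J d := by
  let μ : (MPRing K k n ⧸ J) →ₗ[K] (MPRing K k n ⧸ J) :=
    LinearMap.mulLeft K (Ideal.Quotient.mk J x)
  have hμ : Function.Injective μ := by
    rw [injective_iff_map_eq_zero]
    intro a ha
    obtain ⟨g, rfl⟩ := Ideal.Quotient.mk_surjective a
    rw [LinearMap.mulLeft_apply, ← map_mul, Ideal.Quotient.eq_zero_iff_mem] at ha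
    exact Ideal.Quotient.eq_zero_iff_mem.2 (hreg g ha)
  rw [hilb_exact (J' := J ⊔ Ideal.span {x}) le_sup_left (e + d) ((piece J d).map μ),
    finrank_map_eq_of_injective hμ]
  · rfl
  intro a
  constructor
  · rintro ⟨_, ⟨f, hf, rfl⟩, rfl⟩
    exact ⟨x * f, hx.mul hf, mem_sup_span_singleton.2 ⟨0, J.zero_mem, f, by ring⟩, rfl⟩
  · rintro ⟨f, hf, hfJ, rfl⟩
    obtain ⟨j, hj, b, rfl⟩ := mem_sup_span_singleton.1 hfJ
    refine ⟨_, ⟨weightedHomogeneousComponent (wt k n) d b,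
      weightedHomogeneousComponent_mem _ _ _, rfl⟩, ?_⟩
    change Ideal.Quotient.mk J x * Ideal.Quotient.mk J _ = _
    rw [← map_mul, Ideal.Quotient.eq]
    have h1 := hf.weightedHomogeneousComponent_same
    have h2 : weightedHomogeneousComponent (wt k n) (e + d) (x * b) =
        x * weightedHomogeneousComponent (wt k n) d b := by
      rw [← decompose_eq, DirectSum.coe_decompose_mul_add_of_left_mem _ hx, decompose_eq]
    rw [← h1, map_add, h2, sub_add_cancel_right]
    exact J.neg_mem (weightedHomogeneousComponent_mem_of_mem K (wt k n) hJ hj _)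

end Graded

section Delta

variable {k : ℕ}

/-- The generating function of a numerical function. -/
def genFun (H : (Fin k → ℕ) → ℤ) : MvPowerSeries (Fin k) ℤ := fun s => H s

lemma coeff_genFun (H : (Fin k → ℕ) → ℤ) (d : Fin k →₀ ℕ) :
    MvPowerSeries.coeff d (genFun H) = H d := rfl

lemma coeff_X_mul_genFun (H : (Fin k → ℕ) → ℤ) (i : Fin k) (d : Fin k →₀ ℕ) :
    MvPowerSeries.coeff d (MvPowerSeries.X i * genFun H) =
      if d i = 0 then 0 else H (d - Finsupp.single i 1 : Fin k →₀ ℕ) := by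
  classical
  rw [MvPowerSeries.X, MvPowerSeries.coeff_monomial_mul]
  simp only [Finsupp.single_le_iff, Nat.one_le_iff_ne_zero, one_mul, coeff_genFun]
  split_ifs <;> simp_all

lemma prod_one_sub_X :
    ∏ i : Fin k, (1 - MvPowerSeries.X i : MvPowerSeries (Fin k) ℤ) =
      ∑ l : Fin k → Fin 2, MvPowerSeries.monomial
        (Finsupp.equivFunOnFinite.symm fun i => (l i : ℕ)) ((-1 : ℤ) ^ ∑ i, (l i : ℕ)) := by
  classical
  have h1 : ∀ i : Fin k, (1 - MvPowerSeries.X i : MvPowerSeries (Fin k) ℤ) =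
      ∑ a : Fin 2, MvPowerSeries.monomial (Finsupp.single i (a : ℕ)) ((-1 : ℤ) ^ (a : ℕ)) := by
    intro i
    rw [Fin.sum_univ_two]
    simp [MvPowerSeries.X, sub_eq_add_neg]
  rw [Finset.prod_congr rfl fun i _ => h1 i, Finset.prod_univ_sum, Fintype.piFinset_univ]
  refine Finset.sum_congr rfl fun l _ => ?_
  rw [MvPowerSeries.prod_monomial]
  congr 1
  · congr 1
    ext j
    simp [Finsupp.single_apply, Finsupp.finsetSum_apply]
  · rw [Finset.prod_pow_eq_pow_sum]

lemma coeff_prod_mul_genFun (H : (Fin k → ℕ) → ℕ) (d : Fin k → ℕ) :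
    MvPowerSeries.coeff (Finsupp.equivFunOnFinite.symm d)
      ((∏ i : Fin k, (1 - MvPowerSeries.X i)) * genFun fun d => (H d : ℤ)) = delta k H d := by
  classical
  rw [prod_one_sub_X, Finset.sum_mul, map_sum, delta]
  refine Finset.sum_congr rfl fun l _ => ?_
  rw [MvPowerSeries.coeff_monomial_mul, extNeg]
  have : (Finsupp.equivFunOnFinite.symm (fun i => (l i : ℕ)) ≤ Finsupp.equivFunOnFinite.symm d) ↔
      ∀ i, 0 ≤ (d i : ℤ) - (l i : ℕ) := by
    refine forall_congr' fun i => ?_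
    simp
  simp only [this]
  split_ifs
  · rw [coeff_genFun]
    congr 3
    ext i
    simp
  · simp

lemma delta_eq_of_steps (h : ℕ → (Fin k → ℕ) → ℕ)
    (h0 : ∀ i : Fin k, ∀ d : Fin k → ℕ, d i = 0 → h i d = h (i + 1) d)
    (h1 : ∀ i : Fin k, ∀ d : Fin k → ℕ,
      h i (Pi.single i 1 + d) = h (i + 1) (Pi.single i 1 + d) + h i d) (d : Fin k → ℕ) :
    delta k (h 0) d = h k d := by
  classical
  have step : ∀ i : Fin k, (1 - MvPowerSeries.X i) * genFun (fun d => (h i d : ℤ)) =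
      genFun fun d => (h (i + 1) d : ℤ) := by
    intro i
    ext d
    rw [sub_mul, one_mul, map_sub, coeff_X_mul_genFun, coeff_genFun, coeff_genFun]
    split_ifs with hd
    · rw [h0 i d hd, sub_zero]
    · have := h1 i ((d - Finsupp.single i 1 : Fin k →₀ ℕ))
      have hd' : (Pi.single i 1 : Fin k → ℕ) + ((d - Finsupp.single i 1 : Fin k →₀ ℕ) : Fin k → ℕ) = d := by
        ext j
        rcases eq_or_ne j i with rfl | hj
        · simp; omega
        · simp [hj]
      rw [hd'] at this
      rw [this]
      push_cast
      ring
  have key : ∀ m (hm : m ≤ k), (∏ i ∈ Finset.univ.filter (fun i : Fin k => (i : ℕ) < m),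
      (1 - MvPowerSeries.X i)) * genFun (fun d => (h 0 d : ℤ)) = genFun fun d => (h m d : ℤ) := by
    intro m
    induction m with
    | zero => intro _; simp
    | succ m ih =>
      intro hm
      rw [← step ⟨m, hm⟩, ← ih (by omega), ← mul_assoc]
      congr 1
      rw [← Finset.prod_insert (f := fun i : Fin k => (1 - MvPowerSeries.X i :
        MvPowerSeries (Fin k) ℤ)) (a := ⟨m, hm⟩) (by simp)]
      congr 1
      ext j
      simp only [Finset.mem_filter, Finset.mem_univ, true_and, Finset.mem_insert, Fin.ext_iff]
      omega
  rw [← coeff_prod_mul_genFun]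
  have := key k le_rfl
  rw [Finset.filter_true_of_mem fun i _ => i.2] at this
  rw [this]
  rfl

lemma delta_injective : Function.Injective (delta k) := by
  intro H H' h
  have : (∏ i : Fin k, (1 - MvPowerSeries.X i)) * genFun (fun d => (H d : ℤ)) =
      (∏ i : Fin k, (1 - MvPowerSeries.X i)) * genFun (fun d => (H' d : ℤ)) := by
    ext d
    have := congrFun h d
    rw [← coeff_prod_mul_genFun, ← coeff_prod_mul_genFun] at this
    rwa [show d = Finsupp.equivFunOnFinite.symm d from (Finsupp.equivFunOnFinite_symm_coe d).symm]
  have h2 := mul_left_cancel₀ (Finset.prod_ne_zero_iff.2 fun i _ => ?_) this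
  · funext d
    have := congrArg (MvPowerSeries.coeff (Finsupp.equivFunOnFinite.symm d)) h2
    rw [coeff_genFun, coeff_genFun] at this
    exact_mod_cast this
  · intro h0
    have := congrArg MvPowerSeries.constantCoeff h0
    simp at this

end Delta

section Specialization

variable {K : Type} [Field K] {k : ℕ} {n : Fin k → ℕ}

attribute [local instance] MvPolynomial.weightedGradedAlgebra

/-- The ideal generated by `I` and the first `i` entries of `L`. -/
def prior (I : Ideal (MPRing K k n)) (L : Fin k → MPRing K k n) (i : ℕ) :
    Ideal (MPRing K k n) :=
  I ⊔ Ideal.span (L '' {j | (j : ℕ) < i})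

variable {I : Ideal (MPRing K k n)} {L : Fin k → MPRing K k n}

lemma prior_zero : prior I L 0 = I := by simp [prior]

lemma prior_succ (i : Fin k) : prior I L (i + 1) = prior I L i ⊔ Ideal.span {L i} := by
  rw [prior, prior, sup_assoc, ← Ideal.span_union, ← Set.image_singleton, ← Set.image_union]
  congr 3
  ext j
  simp only [Set.mem_ofPred_eq, Set.mem_union, Set.mem_singleton_iff, Fin.ext_iff]
  omega

lemma le_prior (i : ℕ) : I ≤ prior I L i := le_sup_left

lemma mem_prior {i : ℕ} {j : Fin k} (h : (j : ℕ) < i) : L j ∈ prior I L i :=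
  Ideal.mem_sup_right (Ideal.subset_span ⟨j, h, rfl⟩)

lemma prior_le {i : ℕ} {J : Ideal (MPRing K k n)} (hI : I ≤ J) (hL : ∀ j, L j ∈ J) :
    prior I L i ≤ J := by
  refine sup_le hI (Ideal.span_le.2 ?_)
  rintro _ ⟨j, -, rfl⟩
  exact hL j

lemma IsHomogR.prior (hI : IsHomogR I)
    (hL : ∀ i, IsWeightedHomogeneous (wt k n) (L i) (Pi.single i 1)) (i : ℕ) :
    IsHomogR (prior I L i) := by
  refine Ideal.IsHomogeneous.sup hI (Ideal.homogeneous_span _ _ ?_)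
  rintro _ ⟨j, -, rfl⟩
  exact ⟨_, hL j⟩

lemma delta_hilb (hI : IsHomogR I)
    (hL : ∀ i, IsWeightedHomogeneous (wt k n) (L i) (Pi.single i 1))
    (hreg : ∀ i : Fin k, RegMod (prior I L i) (L i)) (d : Fin k → ℕ) :
    delta k (hilb K k n I) d = hilb K k n (prior I L k) d := by
  have := delta_eq_of_steps (fun i => hilb K k n (prior I L i))
    (fun i d hd => by
      simp only [prior_succ]
      exact hilb_of_zero (hI.prior hL i) (hL i) hd)
    (fun i d => by
      simp only [prior_succ]
      exact hilb_succ (hI.prior hL i) (hreg i) (hL i) d) d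
  simpa only [prior_zero] using this

/-- The substitution `x_{i,j} ↦ v_{i,j} t_i`. -/
def spec (v : Sig k n → K) : MPRing K k n →ₐ[K] MvPolynomial (Fin k) K :=
  aeval fun p => C (v p) * X p.1

lemma spec_monomial (v : Sig k n → K) (s : Sig k n →₀ ℕ) (a : K) :
    spec v (monomial s a) = monomial (Finsupp.equivFunOnFinite.symm (Finsupp.weight (wt k n) s))
      (eval v (monomial s a)) := by
  classical
  rw [spec, aeval_monomial, eval_monomial, ← C_mul_monomial, algebraMap_eq]
  congr 1
  rw [monomial_eq, Finsupp.prod_fintype _ _ (by simp), Finsupp.prod_fintype _ _ (by simp),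
    Finsupp.prod_fintype _ _ (by simp)]
  simp only [mul_pow, Finset.prod_mul_distrib, map_prod, map_pow]
  congr 1
  rw [Fintype.prod_sigma]
  refine Finset.prod_congr rfl fun i _ => ?_
  rw [Finset.prod_pow_eq_pow_sum (a := (X i : MvPolynomial (Fin k) K))]
  congr 1
  exact (weight_wt_apply s i).symm

lemma spec_of_homog (v : Sig k n → K) {f : MPRing K k n} {d : Fin k → ℕ}
    (hf : IsWeightedHomogeneous (wt k n) f d) :
    spec v f = monomial (Finsupp.equivFunOnFinite.symm d) (eval v f) := by
  conv_lhs => rw [f.as_sum]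
  conv_rhs => rw [f.as_sum]
  rw [map_sum, map_sum, map_sum]
  refine Finset.sum_congr rfl fun s hs => ?_
  rw [spec_monomial, hf (mem_support_iff.1 hs)]

lemma coeff_spec (v : Sig k n → K) (f : MPRing K k n) (d : Fin k → ℕ) :
    coeff (Finsupp.equivFunOnFinite.symm d) (spec v f) =
      eval v (weightedHomogeneousComponent (wt k n) d f) := by
  classical
  conv_lhs => rw [← sum_weightedHomogeneousComponent (wt k n) f]
  rw [finsum_eq_sum _ (weightedHomogeneousComponent_finsupp (w := wt k n) f), map_sum, coeff_sum]
  simp only [spec_of_homog v (weightedHomogeneousComponent_isWeightedHomogeneous _ _), coeff_monomial,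
    EmbeddingLike.apply_eq_iff_eq]
  rw [Finset.sum_ite_eq']
  split_ifs with h
  · rfl
  · have h0 : weightedHomogeneousComponent (wt k n) d f = 0 := by
      by_contra h0
      exact h ((Set.Finite.mem_toFinset _).2 h0)
    rw [h0, map_zero]

lemma spec_eq_zero_iff (v : Sig k n → K) (f : MPRing K k n) :
    spec v f = 0 ↔ ∀ d, eval v (weightedHomogeneousComponent (wt k n) d f) = 0 := by
  rw [MvPolynomial.ext_iff]
  simp only [← coeff_spec, coeff_zero]
  exact ⟨fun h d => h _, fun h d => Finsupp.equivFunOnFinite_symm_coe d ▸ h d⟩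

lemma isHomogR_ker_spec (v : Sig k n → K) : IsHomogR (RingHom.ker (spec v)) := by
  intro d f hf
  rw [decompose_eq, RingHom.mem_ker, spec_of_homog v (weightedHomogeneousComponent_isWeightedHomogeneous _ _),
    (spec_eq_zero_iff v f).1 hf d, map_zero]

lemma hilb_eq_ite {J : Ideal (MPRing K k n)} (M : Fin k → MPRing K k n)
    (hM : ∀ i, IsWeightedHomogeneous (wt k n) (M i) (Pi.single i 1))
    (v : Sig k n → K) (hv : ∀ p, X p - C (v p) * M p.1 ∈ J) (d : Fin k → ℕ)
    [Decidable (∏ i, M i ^ d i ∈ J)] :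
    hilb K k n J d = if ∏ i, M i ^ d i ∈ J then 0 else 1 := by
  have key : ∀ f, IsWeightedHomogeneous (wt k n) f d →
      Ideal.Quotient.mk J f = eval v f • Ideal.Quotient.mk J (∏ i, M i ^ d i) := by
    intro f hf
    have h1 : Ideal.Quotient.mkₐ K J =
        ((Ideal.Quotient.mkₐ K J).comp (aeval M)).comp (spec v) := by
      refine algHom_ext fun p => ?_
      simp only [AlgHom.comp_apply, spec, aeval_X, map_mul, algHom_C, algebraMap_eq]
      have := Ideal.Quotient.eq.2 (hv p)
      rwa [map_mul] at this
    have h2 := AlgHom.congr_fun h1 f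
    rw [AlgHom.comp_apply, spec_of_homog v hf, AlgHom.comp_apply, aeval_monomial,
      Finsupp.prod_fintype _ _ (by simp), ← Algebra.smul_def, map_smul] at h2
    exact h2
  have hMd : IsWeightedHomogeneous (wt k n) (∏ i, M i ^ d i) d := by
    have := IsWeightedHomogeneous.prod Finset.univ (fun i => M i ^ d i)
      (fun i => d i • Pi.single i 1) (w := wt k n) fun i _ => (hM i).pow (d i)
    convert this
    ext j
    simp [Finset.sum_apply, Pi.single_apply]
  have hp : piece J d = Submodule.span K {Ideal.Quotient.mk J (∏ i, M i ^ d i)} := by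
    ext a
    rw [Submodule.mem_span_singleton]
    constructor
    · rintro ⟨f, hf, rfl⟩
      exact ⟨_, (key f hf).symm⟩
    · rintro ⟨c, rfl⟩
      exact Submodule.smul_mem _ _ ⟨_, hMd, rfl⟩
  change Module.finrank K (piece J d) = _
  rw [hp]
  split_ifs with h
  · rw [Ideal.Quotient.eq_zero_iff_mem.2 h, Submodule.span_zero_singleton, finrank_bot]
  · exact finrank_span_singleton fun h0 => h (Ideal.Quotient.eq_zero_iff_mem.1 h0)

end Specialization

section Points

variable {K : Type} [Field K] {k : ℕ} {n : Fin k → ℕ}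

attribute [local instance] MvPolynomial.weightedGradedAlgebra

/-- The chosen homogeneous coordinates of a point. -/
def coords (P : MPPoint K k n) : Sig k n → K := fun p => (P p.1).rep p.2

lemma eval_spec (v : Sig k n → K) (c : Fin k → K) (f : MPRing K k n) :
    eval c (spec v f) = eval (fun p => v p * c p.1) f := by
  have : ((aeval c).comp (spec v) : MPRing K k n →ₐ[K] K) = aeval fun p => v p * c p.1 := by
    refine algHom_ext fun p => ?_
    simp [spec]
  have := AlgHom.congr_fun this f
  simpa [aeval_eq_eval] using this

lemma mem_idealOfPoint_of_smul [Infinite K] {P : MPPoint K k n} {v : Sig k n → K}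
    (hv : ∀ i, ∃ a : K, a ≠ 0 ∧ ∀ j, (P i).rep j = a * v ⟨i, j⟩) {f : MPRing K k n} :
    f ∈ idealOfPoint K k n P ↔ spec v f = 0 := by
  choose a ha hav using hv
  have h1 : f ∈ idealOfPoint K k n P ↔ ∀ x ∈ cone K k n P, eval x f = 0 := by
    simp [idealOfPoint, vanishingIdeal, Submodule.mem_iInf, RingHom.mem_ker]
  rw [h1]
  constructor
  · intro h
    refine MvPolynomial.funext fun c => ?_
    rw [eval_spec, map_zero]
    refine h _ fun i => ⟨c i * (a i)⁻¹, ?_⟩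
    ext j
    rw [Pi.smul_apply, smul_eq_mul, hav]
    have := ha i
    field_simp
  · intro h x hx
    choose c hc using hx
    have := eval_spec v (fun i => c i * a i) f
    rw [h, map_zero] at this
    rw [this]
    congr 2
    ext ⟨i, j⟩
    have := congrFun (hc i) j
    simp only [Pi.smul_apply, smul_eq_mul, hav] at this
    rw [this]
    ring

lemma mem_idealOfPoint [Infinite K] {P : MPPoint K k n} {f : MPRing K k n} :
    f ∈ idealOfPoint K k n P ↔ spec (coords P) f = 0 :=
  mem_idealOfPoint_of_smul fun _ => ⟨1, one_ne_zero, fun _ => (one_mul _).symm⟩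

lemma mem_idealOfSet {X : Set (MPPoint K k n)} {f : MPRing K k n} :
    f ∈ idealOfSet K k n X ↔ ∀ P ∈ X, f ∈ idealOfPoint K k n P := by
  simp [idealOfSet, Submodule.mem_iInf]

lemma isHomogR_idealOfSet [Infinite K] (X : Set (MPPoint K k n)) :
    IsHomogR (idealOfSet K k n X) := by
  refine Ideal.IsHomogeneous.iInf₂ (𝒜 := weightedHomogeneousSubmodule K (wt k n)) fun P _ => ?_
  have : idealOfPoint K k n P = RingHom.ker (spec (coords P)) := by
    ext f
    rw [mem_idealOfPoint, RingHom.mem_ker]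
  rw [this]
  exact isHomogR_ker_spec _

lemma coords_ne_zero (P : MPPoint K k n) (i : Fin k) : ∃ j, coords P ⟨i, j⟩ ≠ 0 := by
  by_contra! h
  exact (P i).rep_nonzero (_root_.funext h)

lemma ne_top_of_mem [Infinite K] {X : Set (MPPoint K k n)} {P : MPPoint K k n} (hP : P ∈ X) :
    idealOfSet K k n X ≠ ⊤ := by
  intro h
  have := mem_idealOfPoint.1 (mem_idealOfSet.1 ((Ideal.eq_top_iff_one _).1 h) P hP)
  simp at this

lemma relation_mem_idealOfPoint [Infinite K] (P : MPPoint K k n) {i : Fin k} {f : MPRing K k n}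
    (hf : IsWeightedHomogeneous (wt k n) f (Pi.single i 1)) (j : Fin (n i + 1)) :
    C (eval (coords P) f) * X ⟨i, j⟩ - C (coords P ⟨i, j⟩) * f ∈ idealOfPoint K k n P := by
  classical
  rw [mem_idealOfPoint, map_sub, map_mul, map_mul, spec_of_homog _ hf, spec, aeval_X, algHom_C,
    algHom_C, algebraMap_eq]
  have : (monomial (Finsupp.equivFunOnFinite.symm (Pi.single i 1 : Fin k → ℕ)))
      (eval (coords P) f) = C (eval (coords P) f) * X i := by
    rw [X, C_mul_monomial, mul_one]
    congr 2
    ext j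
    simp [Finsupp.single_apply]
  rw [this]
  ring

lemma ringKrullDim_le [Infinite K] {S : Set (MPPoint K k n)} (hS : S.Finite)
    {p : Ideal (MPRing K k n)} [p.IsPrime] (hp : idealOfSet K k n S ≤ p)
    {L : Fin k → MPRing K k n}
    (hL : ∀ i, IsWeightedHomogeneous (wt k n) (L i) (Pi.single i 1))
    (hLS : ∀ P ∈ S, ∀ i, eval (coords P) (L i) ≠ 0) {m : ℕ}
    (hm : ∀ j : Fin k, (j : ℕ) < m → L j ∈ p) :
    ringKrullDim (MPRing K k n ⧸ p) ≤ (k - m : ℕ) := by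
  obtain ⟨P, hPS, hP⟩ : ∃ P ∈ S, idealOfPoint K k n P ≤ p := by
    have : hS.toFinset.inf (idealOfPoint K k n) ≤ p := by
      rw [Finset.inf_eq_iInf]
      simpa [idealOfSet] using hp
    obtain ⟨P, hP, h⟩ := (Ideal.IsPrime.inf_le' ‹_›).1 this
    exact ⟨P, by simpa using hP, h⟩
  let g : MvPolynomial {j : Fin k // m ≤ j} K →ₐ[K] MPRing K k n ⧸ p :=
    aeval fun j => Ideal.Quotient.mk p (L j)
  have hg : Function.Surjective g := by
    intro a
    obtain ⟨f, rfl⟩ := Ideal.Quotient.mk_surjective a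
    change Ideal.Quotient.mkₐ K p f ∈ g.range
    have : g.range.comap (Ideal.Quotient.mkₐ K p) = ⊤ := by
      rw [eq_top_iff, ← adjoin_range_X, Algebra.adjoin_le_iff]
      rintro _ ⟨⟨i, j⟩, rfl⟩
      rw [SetLike.mem_coe, Subalgebra.mem_comap]
      have h1 : Ideal.Quotient.mkₐ K p (L i) ∈ g.range := by
        by_cases him : m ≤ i
        · exact ⟨X ⟨i, him⟩, aeval_X _ _⟩
        · have : Ideal.Quotient.mkₐ K p (L i) = 0 :=
            Ideal.Quotient.eq_zero_iff_mem.2 (hm i (by omega))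
          rw [this]
          exact zero_mem _
      have h2 := hP (relation_mem_idealOfPoint P (hL i) j)
      have h3 : eval (coords P) (L i) • Ideal.Quotient.mkₐ K p (X ⟨i, j⟩) =
          coords P ⟨i, j⟩ • Ideal.Quotient.mkₐ K p (L i) := by
        rw [← map_smul, ← map_smul, smul_eq_C_mul, smul_eq_C_mul]
        exact Ideal.Quotient.eq.2 h2
      have h4 := (eq_inv_smul_iff₀ (hLS P hPS i)).2 h3
      rw [h4]
      exact g.range.smul_mem (g.range.smul_mem h1 _) _
    exact (this.symm ▸ Algebra.mem_top : f ∈ g.range.comap (Ideal.Quotient.mkₐ K p))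
  refine (ringKrullDim_le_of_surjective g.toRingHom hg).trans ?_
  rw [MvPolynomial.ringKrullDim_of_isNoetherianRing, ringKrullDim_eq_zero_of_field, zero_add]
  have : Nat.card {j : Fin k // m ≤ j} ≤ Nat.card (Fin (k - m)) :=
    Nat.card_le_card_of_injective (fun j => ⟨j.1 - m, by have := j.1.2; have := j.2; omega⟩) <| by
      intro a b hab
      have h1 := a.2
      have h2 := b.2
      simp only [Fin.mk.injEq] at hab
      ext
      omega
  rw [Nat.card_fin] at this
  exact_mod_cast this

end Points

section Necessity

variable {K : Type} [Field K] {k : ℕ}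

attribute [local instance] MvPolynomial.weightedGradedAlgebra

lemma IsRegSeqMod.depthGE {n : Fin k → ℕ} {L : List (MPRing K k n)} :
    ∀ {I : Ideal (MPRing K k n)}, IsRegSeqMod K k n I L → DepthGE (maxIdeal K k n) L.length I := by
  have hspan : ∀ (f : MPRing K k n) (l : List (MPRing K k n)),
      Ideal.span {g | g ∈ f :: l} = Ideal.span {f} ⊔ Ideal.span {g | g ∈ l} := by
    intro f l
    rw [← Ideal.span_insert]
    congr 1
    ext g
    simp
  induction L with
  | nil => intro I _; trivial
  | cons f L ih =>
    intro I hI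
    obtain ⟨hle, hreg⟩ := hI
    refine ⟨f, hle (Ideal.mem_sup_right (Ideal.subset_span (by simp))), ?_, ih ⟨?_, ?_⟩⟩
    · simpa [RegMod] using hreg ⟨0, by simp⟩
    · rwa [sup_assoc, ← hspan]
    · intro i G hG
      have := hreg i.succ G
      simp only [Fin.val_succ, List.take_succ_cons, hspan, ← sup_assoc] at this
      exact this hG

lemma regMod_prior [Infinite K] {n : Fin k → ℕ} {S : Set (MPPoint K k n)} (hS : S.Finite)
    (hdepth : DepthGE (maxIdeal K k n) k (idealOfSet K k n S)) {L : Fin k → MPRing K k n}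
    (hL : ∀ i, IsWeightedHomogeneous (wt k n) (L i) (Pi.single i 1))
    (hLm : ∀ i, L i ∈ maxIdeal K k n)
    (hLS : ∀ P ∈ S, ∀ i, eval (coords P) (L i) ≠ 0) (i : Fin k) :
    RegMod (prior (idealOfSet K k n S) L i) (L i) := by
  set I := idealOfSet K k n S
  have step : ∀ i : Fin k, DepthGE (maxIdeal K k n) (k - i) (prior I L i) →
      RegMod (prior I L i) (L i) := by
    intro i hi G hG
    by_contra hGJ
    obtain ⟨p, hp, hGp, hdim⟩ := hi.exists_prime (u := G) fun s hs => by
      by_contra hsm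
      exact hGJ (((isHomogR_idealOfSet S).prior hL i).mem_of_mul_mem hsm hs)
    have hJp : prior I L i ≤ p := fun a ha => hGp a (Ideal.mul_mem_right _ _ ha)
    have := ringKrullDim_le hS ((le_prior _).trans hJp) hL hLS (m := i + 1) fun j hj => by
      rcases Nat.lt_succ_iff_lt_or_eq.1 hj with h | h
      · exact hJp (mem_prior h)
      · rw [Fin.ext h]
        exact hGp _ hG
    have h1 : k - (i : ℕ) ≤ k - (i + 1) := by exact_mod_cast hdim.trans this
    have := i.2
    omega
  have key : ∀ m, m ≤ k → DepthGE (maxIdeal K k n) (k - m) (prior I L m) := by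
    intro m
    induction m with
    | zero => intro _; rwa [prior_zero]
    | succ m ih =>
      intro hm
      have h1 := ih (by omega)
      have h2 := step ⟨m, hm⟩ h1
      have := prior_succ (I := I) (L := L) ⟨m, hm⟩
      simp only at this
      rw [this]
      rw [show k - m = k - (m + 1) + 1 by omega] at h1
      exact h1.sup_span (hLm _) h2
  exact step i (key i i.2.le)

lemma isWeightedHomogeneous_X' {n : Fin k → ℕ} (p : Sig k n) :
    IsWeightedHomogeneous (wt k n) (X p : MPRing K k n) (Pi.single p.1 1) :=
  isWeightedHomogeneous_X K (wt k n) p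

lemma X_mem_maxIdeal {n : Fin k → ℕ} (p : Sig k n) : (X p : MPRing K k n) ∈ maxIdeal K k n :=
  Ideal.subset_span ⟨p, rfl⟩

lemma exists_linear_form [Infinite K] {S : Set (MPPoint K k fun _ => 1)} (hS : S.Finite)
    (i : Fin k) : ∃ c : K, ∀ P ∈ S, coords P ⟨i, 1⟩ - c * coords P ⟨i, 0⟩ ≠ 0 := by
  obtain ⟨c, hc⟩ := (hS.image fun P => coords P ⟨i, 1⟩ / coords P ⟨i, 0⟩).exists_notMem
  refine ⟨c, fun P hP h => ?_⟩
  by_cases h0 : coords P ⟨i, 0⟩ = 0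
  · obtain ⟨j, hj⟩ := coords_ne_zero P i
    rw [h0, mul_zero, sub_zero] at h
    fin_cases j
    · exact hj h0
    · exact hj h
  · exact hc ⟨P, hP, (div_eq_iff h0).2 (sub_eq_zero.1 h)⟩

lemma delta_of_isACM [Infinite K] {S : Set (MPPoint K k fun _ => 1)} (hS : S.Finite)
    (hACM : IsACM K k (fun _ => 1) S) {H : (Fin k → ℕ) → ℕ}
    (hH : hilb K k (fun _ => 1) (idealOfSet K k (fun _ => 1) S) = H) :
    delta k H 0 = 1 ∧
      (∀ d : Fin k → ℕ, d ≠ 0 → delta k H d = 0 ∨ delta k H d = 1) ∧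
      (∀ d : Fin k → ℕ, delta k H d = 0 → ∀ j : Fin k → ℕ, d ≤ j → delta k H j = 0) ∧
      (∀ i : Fin k, ∃ t : ℕ, delta k H (Pi.single i t) = 0) := by
  classical
  obtain ⟨l, hl, hreg⟩ := hACM.1
  have hdepth := hreg.depthGE
  rw [hl] at hdepth
  have hIm := le_sup_left.trans hreg.1
  choose c hc using exists_linear_form hS
  let L : Fin k → MPRing K k (fun _ => 1) := fun i => X ⟨i, 1⟩ - C (c i) * X ⟨i, 0⟩
  let M : Fin k → MPRing K k (fun _ => 1) := fun i => X ⟨i, 0⟩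
  let v : Sig k (fun _ => 1) → K := fun p => if p.2 = 0 then 1 else c p.1
  have hM : ∀ i, IsWeightedHomogeneous (wt k fun _ => 1) (M i) (Pi.single i 1) := fun i =>
    isWeightedHomogeneous_X' _
  have hL : ∀ i, IsWeightedHomogeneous (wt k fun _ => 1) (L i) (Pi.single i 1) := fun i => by
    refine (isWeightedHomogeneous_X' _).sub ?_
    simpa using (isWeightedHomogeneous_C (wt k fun _ => 1) (c i)).mul (hM i)
  have hLm : ∀ i, L i ∈ maxIdeal K k (fun _ => 1) := fun i =>
    Ideal.sub_mem _ (X_mem_maxIdeal _) (Ideal.mul_mem_left _ _ (X_mem_maxIdeal _))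
  have hLS : ∀ P ∈ S, ∀ i, eval (coords P) (L i) ≠ 0 := fun P hP i => by
    simpa [L] using hc i P hP
  set I := idealOfSet K k (fun _ => 1) S
  set J := prior I L k
  have hJm : J ≤ maxIdeal K k (fun _ => 1) := prior_le hIm hLm
  have hv : ∀ p : Sig k (fun _ => 1), X p - C (v p) * M p.1 ∈ J := by
    rintro ⟨i, j⟩
    fin_cases j
    · simp [v, M]
    · simpa [v, M] using (mem_prior i.2 : L i ∈ J)
  have hdelta : ∀ d, delta k H d = if ∏ i, M i ^ d i ∈ J then 0 else 1 := by
    intro d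
    rw [← hH, delta_hilb (isHomogR_idealOfSet S) hL (regMod_prior hS hdepth hL hLm hLS),
      hilb_eq_ite M hM v hv]
    split_ifs <;> rfl
  have hzero : ∀ d, delta k H d = 0 ↔ ∏ i, M i ^ d i ∈ J := by
    intro d
    rw [hdelta]
    split_ifs with h <;> simp [h]
  refine ⟨?_, fun d _ => ?_, fun d hd j hdj => ?_, fun i => ?_⟩
  · rw [hdelta, if_neg]
    simpa using fun h => Ideal.IsPrime.ne_top isPrime_maxIdeal ((Ideal.eq_top_iff_one _).2 (hJm h))
  · rw [hdelta]
    split_ifs <;> simp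
  · rw [hzero] at hd ⊢
    have : ∏ i, M i ^ j i = (∏ i, M i ^ (j i - d i)) * ∏ i, M i ^ d i := by
      rw [← Finset.prod_mul_distrib]
      exact Finset.prod_congr rfl fun i _ => by rw [← pow_add, Nat.sub_add_cancel (hdj i)]
    rw [this]
    exact J.mul_mem_left _ hd
  · refine ⟨hS.toFinset.card, (hzero _).2 ?_⟩
    rw [Finset.prod_eq_single i (by intro j _ hj; simp [hj]) (by simp), Pi.single_eq_same]
    let g : MPPoint K k (fun _ => 1) → MPRing K k (fun _ => 1) := fun P =>
      C (coords P ⟨i, 1⟩) * X ⟨i, 0⟩ - C (coords P ⟨i, 0⟩) * X ⟨i, 1⟩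
    have h1 : ∏ P ∈ hS.toFinset, g P ∈ I := by
      rw [mem_idealOfSet]
      intro P hP
      refine Ideal.mem_of_dvd _ (Finset.dvd_prod_of_mem g (hS.mem_toFinset.2 hP)) ?_
      rw [mem_idealOfPoint]
      simp only [g, spec, map_sub, map_mul, algHom_C, aeval_X, algebraMap_eq]
      ring
    have h2 : ∀ P, Ideal.Quotient.mk J (g P) =
        Ideal.Quotient.mk J (C (coords P ⟨i, 1⟩ - c i * coords P ⟨i, 0⟩) * M i) := by
      intro P
      rw [Ideal.Quotient.eq]
      have : g P - C (coords P ⟨i, 1⟩ - c i * coords P ⟨i, 0⟩) * M i =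
          -C (coords P ⟨i, 0⟩) * L i := by
        simp only [g, L, M, map_sub, map_mul]
        ring
      rw [this]
      exact J.mul_mem_left _ (mem_prior i.2)
    have h3 := Ideal.Quotient.eq_zero_iff_mem.2 (le_prior k h1 : _ ∈ J)
    rw [map_prod, Finset.prod_congr rfl fun P _ => h2 P, ← map_prod, Finset.prod_mul_distrib,
      ← map_prod, Finset.prod_const, Ideal.Quotient.eq_zero_iff_mem] at h3
    have hu : IsUnit (C (∏ P ∈ hS.toFinset, (coords P ⟨i, 1⟩ - c i * coords P ⟨i, 0⟩)) :
        MPRing K k (fun _ => 1)) :=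
      (Finset.prod_ne_zero_iff.2 fun P hP => hc i P (hS.mem_toFinset.1 hP)).isUnit.map C
    exact (Ideal.unit_mul_mem_iff_mem _ hu).1 h3

end Necessity

section Sufficiency

variable {K : Type} [Field K] {k : ℕ}

attribute [local instance] MvPolynomial.weightedGradedAlgebra

/-- The exponents of the variables `x_{i,1}`. -/
def snd (s : Sig k (fun _ => 1) →₀ ℕ) : Fin k → ℕ := fun i => s ⟨i, 1⟩

variable (K) in
/-- The lift `∏ x_{i,0}^{s_{i,0}} ∏_{l < s_{i,1}} (x_{i,1} - l x_{i,0})` of a monomial. -/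
def fallForm (s : Sig k (fun _ => 1) →₀ ℕ) : MPRing K k (fun _ => 1) :=
  ∏ i, (X ⟨i, 0⟩ ^ s ⟨i, 0⟩ *
    ∏ l ∈ Finset.range (s ⟨i, 1⟩), (X ⟨i, 1⟩ - C (l : K) * X ⟨i, 0⟩))

lemma fallForm_zero : fallForm K (0 : Sig k (fun _ => 1) →₀ ℕ) = 1 := by
  simp [fallForm]

lemma fallForm_add_single_zero (s : Sig k (fun _ => 1) →₀ ℕ) (i : Fin k) :
    fallForm K (Finsupp.single ⟨i, 0⟩ 1 + s) = X ⟨i, 0⟩ * fallForm K s := by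
  classical
  rw [fallForm, fallForm, ← Finset.mul_prod_erase _ _ (Finset.mem_univ i),
    ← Finset.mul_prod_erase _ _ (Finset.mem_univ i), ← mul_assoc]
  congr 1
  · simp [pow_add, mul_assoc]
  · refine Finset.prod_congr rfl fun j hj => ?_
    have := Finset.ne_of_mem_erase hj
    simp [this.symm]

lemma fallForm_add_single_one (s : Sig k (fun _ => 1) →₀ ℕ) (i : Fin k) :
    fallForm K (Finsupp.single ⟨i, 1⟩ 1 + s) =
      (X ⟨i, 1⟩ - C (s ⟨i, 1⟩ : K) * X ⟨i, 0⟩) * fallForm K s := by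
  classical
  rw [fallForm, fallForm, ← Finset.mul_prod_erase _ _ (Finset.mem_univ i),
    ← Finset.mul_prod_erase _ _ (Finset.mem_univ i), ← mul_assoc]
  congr 1
  · simp only [Finsupp.add_apply, Finsupp.single_eq_same, add_comm 1, Finset.prod_range_succ]
    simp
    ring
  · refine Finset.prod_congr rfl fun j hj => ?_
    have := Finset.ne_of_mem_erase hj
    simp [this.symm]

lemma isWeightedHomogeneous_fallForm (s : Sig k (fun _ => 1) →₀ ℕ) :
    IsWeightedHomogeneous (wt k fun _ => 1) (fallForm K s)
      (Finsupp.weight (wt k fun _ => 1) s) := by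
  have hX : ∀ p : Sig k fun _ => 1, IsWeightedHomogeneous (wt k fun _ => 1)
    (X p : MPRing K k fun _ => 1) (Pi.single p.1 1) := isWeightedHomogeneous_X'
  have hlin : ∀ (i : Fin k) (l : ℕ), IsWeightedHomogeneous (wt k fun _ => 1)
      (X ⟨i, 1⟩ - C (l : K) * X ⟨i, 0⟩ : MPRing K k fun _ => 1) (Pi.single i 1) := fun i l => by
    refine (hX ⟨i, 1⟩).sub ?_
    simpa using (isWeightedHomogeneous_C (wt k fun _ => 1) (l : K)).mul (hX ⟨i, 0⟩)
  have hfac : ∀ i : Fin k, IsWeightedHomogeneous (wt k fun _ => 1)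
      (X ⟨i, 0⟩ ^ s ⟨i, 0⟩ * ∏ l ∈ Finset.range (s ⟨i, 1⟩), (X ⟨i, 1⟩ - C (l : K) * X ⟨i, 0⟩) :
        MPRing K k fun _ => 1) (Pi.single i (s ⟨i, 0⟩ + s ⟨i, 1⟩)) := fun i => by
    have h := ((hX ⟨i, 0⟩).pow (s ⟨i, 0⟩)).mul
      (IsWeightedHomogeneous.prod (Finset.range (s ⟨i, 1⟩)) _ _ fun l _ => hlin i l)
    rw [Finset.sum_const, Finset.card_range, ← add_smul, ← Pi.single_smul, smul_eq_mul,
      mul_one] at h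
    exact h
  have h := IsWeightedHomogeneous.prod Finset.univ _ _ fun i _ => hfac i
  rw [fallForm]
  convert h using 1
  ext i
  rw [weight_wt_apply, Fin.sum_univ_two, Finset.sum_apply, Finset.sum_eq_single i]
  · simp
  · intro j _ hj
    simp [hj.symm]
  · simp

variable (K k) in
/-- The linear map replacing monomials by their lifts. -/
def lift : MPRing K k (fun _ => 1) →ₗ[K] MPRing K k (fun _ => 1) :=
  (basisMonomials (Sig k fun _ => 1) K).constr K (fallForm K)

lemma lift_monomial (s : Sig k (fun _ => 1) →₀ ℕ) (a : K) :
    lift K k (monomial s a) = a • fallForm K s := by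
  have : monomial s a = a • basisMonomials (Sig k fun _ => 1) K s := by
    rw [coe_basisMonomials, smul_monomial, smul_eq_mul, mul_one]
  rw [this, map_smul, lift, Module.Basis.constr_basis]

lemma lift_eq_sum (p : MPRing K k (fun _ => 1)) :
    lift K k p = ∑ s ∈ p.support, coeff s p • fallForm K s := by
  conv_lhs => rw [p.as_sum]
  rw [map_sum]
  exact Finset.sum_congr rfl fun s _ => lift_monomial s _

lemma lift_X_mul (i : Fin k) (p : MPRing K k (fun _ => 1)) :
    lift K k (X ⟨i, 0⟩ * p) = X ⟨i, 0⟩ * lift K k p := by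
  induction p using MvPolynomial.induction_on' with
  | monomial s a =>
    rw [X, monomial_mul, one_mul, lift_monomial, lift_monomial, fallForm_add_single_zero, X,
      mul_smul_comm]
  | add p q hp hq => rw [mul_add, map_add, hp, hq, map_add, mul_add]

lemma lift_surjective : Function.Surjective (lift K k) := by
  intro f
  induction f using MvPolynomial.induction_on with
  | C a => exact ⟨monomial 0 a, by rw [lift_monomial, fallForm_zero, smul_eq_C_mul, mul_one]⟩
  | add f g hf hg =>
    obtain ⟨p, rfl⟩ := hf
    obtain ⟨q, rfl⟩ := hg
    exact ⟨p + q, map_add _ _ _⟩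
  | mul_X f r hf =>
    obtain ⟨p, rfl⟩ := hf
    obtain ⟨i, j⟩ := r
    fin_cases j
    · exact ⟨X ⟨i, 0⟩ * p, by rw [lift_X_mul, mul_comm]; rfl⟩
    change ∃ a, lift K k a = lift K k p * X ⟨i, 1⟩
    induction p using MvPolynomial.induction_on' with
    | monomial s a =>
      refine ⟨monomial (Finsupp.single ⟨i, 1⟩ 1 + s) a +
        monomial (Finsupp.single ⟨i, 0⟩ 1 + s) (a * s ⟨i, 1⟩), ?_⟩
      rw [map_add, lift_monomial, lift_monomial, lift_monomial, fallForm_add_single_zero,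
        fallForm_add_single_one]
      simp only [smul_eq_C_mul, map_mul]
      ring
    | add p q hp hq =>
      obtain ⟨a, ha⟩ := hp
      obtain ⟨b, hb⟩ := hq
      exact ⟨a + b, by rw [map_add, ha, hb, map_add, add_mul]⟩

variable (K) in
/-- The affine coordinates `(1, b_i)`. -/
def affCoords (b : Fin k → ℕ) : Sig k (fun _ => 1) → K := fun p => if p.2 = 0 then 1 else b p.1

lemma eval_fallForm (b : Fin k → ℕ) (s : Sig k (fun _ => 1) →₀ ℕ) :
    eval (affCoords K b) (fallForm K s) = ∏ i, ∏ l ∈ Finset.range (snd s i), ((b i : K) - l) := by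
  simp [fallForm, affCoords, snd, map_prod]

lemma eval_fallForm_ne_zero_iff [CharZero K] (b : Fin k → ℕ) (s : Sig k (fun _ => 1) →₀ ℕ) :
    eval (affCoords K b) (fallForm K s) ≠ 0 ↔ snd s ≤ b := by
  rw [eval_fallForm, Finset.prod_ne_zero_iff]
  simp only [Finset.prod_ne_zero_iff, Finset.mem_univ, true_implies, Finset.mem_range, sub_ne_zero,
    Nat.cast_inj, ne_eq, Pi.le_def]
  refine forall_congr' fun i => ⟨fun h => ?_, fun h l hl => ?_⟩
  · by_contra! hlt
    exact h _ hlt rfl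
  · omega

lemma coeff_spec_lift (b d : Fin k → ℕ) (p : MPRing K k (fun _ => 1)) :
    coeff (Finsupp.equivFunOnFinite.symm d) (spec (affCoords K b) (lift K k p)) =
      ∑ s ∈ p.support, if Finsupp.weight (wt k fun _ => 1) s = d then
        coeff s p * eval (affCoords K b) (fallForm K s) else 0 := by
  classical
  rw [lift_eq_sum, map_sum, coeff_sum]
  refine Finset.sum_congr rfl fun s _ => ?_
  rw [map_smul, coeff_smul, spec_of_homog _ (isWeightedHomogeneous_fallForm s), coeff_monomial,
    smul_eq_mul, mul_ite, mul_zero]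
  simp only [EmbeddingLike.apply_eq_iff_eq]

lemma eq_of_snd_eq_of_weight_eq {s t : Sig k (fun _ => 1) →₀ ℕ} (h : snd s = snd t)
    (hw : Finsupp.weight (wt k fun _ => 1) s = Finsupp.weight (wt k fun _ => 1) t) : s = t := by
  ext ⟨i, j⟩
  have h1 := congrFun hw i
  have h2 : s ⟨i, 1⟩ = t ⟨i, 1⟩ := congrFun h i
  rw [weight_wt_apply, weight_wt_apply, Fin.sum_univ_two, Fin.sum_univ_two] at h1
  fin_cases j
  · change s ⟨i, 0⟩ = t ⟨i, 0⟩
    omega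
  · exact h2

lemma spec_lift_eq_zero_iff [CharZero K] {D : Set (Fin k → ℕ)} (hD : IsLowerSet D)
    (p : MPRing K k (fun _ => 1)) :
    (∀ b ∈ D, spec (affCoords K b) (lift K k p) = 0) ↔ ∀ s ∈ p.support, snd s ∉ D := by
  classical
  constructor
  · intro h
    by_contra! hne
    obtain ⟨s, hs, hsD⟩ := hne
    obtain ⟨s₀, hs₀⟩ := (p.support.filter fun s => snd s ∈ D).exists_minimalFor snd
      ⟨s, Finset.mem_filter.2 ⟨hs, hsD⟩⟩
    obtain ⟨hs₀p, hs₀D⟩ := Finset.mem_filter.1 hs₀.1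
    have h1 := coeff_spec_lift (snd s₀) (Finsupp.weight (wt k fun _ => 1) s₀) p
    rw [h _ hs₀D, coeff_zero, Finset.sum_eq_single s₀, if_pos rfl] at h1
    · exact mul_ne_zero (mem_support_iff.1 hs₀p)
        ((eval_fallForm_ne_zero_iff _ _).2 le_rfl) h1.symm
    · intro t ht hts
      by_contra hne
      rw [ite_eq_right_iff, not_forall] at hne
      obtain ⟨hw, hne⟩ := hne
      have hle := (eval_fallForm_ne_zero_iff _ _).1 (right_ne_zero_of_mul hne)
      have := hs₀.2 (Finset.mem_filter.2 ⟨ht, hD hle hs₀D⟩) hle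
      exact hts (eq_of_snd_eq_of_weight_eq (le_antisymm hle this) hw)
    · exact fun h => absurd hs₀p h
  · intro h b hb
    ext d
    rw [← Finsupp.equivFunOnFinite_symm_coe d, coeff_spec_lift, coeff_zero]
    refine Finset.sum_eq_zero fun s hs => ?_
    rw [not_ne_iff.1 fun h0 => h s hs (hD ((eval_fallForm_ne_zero_iff b s).1 h0) hb), mul_zero,
      ite_self]

lemma lift_injective [CharZero K] : Function.Injective (lift K k) := by
  rw [injective_iff_map_eq_zero]
  intro p hp
  have := (spec_lift_eq_zero_iff (D := Set.univ) isLowerSet_univ p).1 (by simp [hp])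
  rw [← support_eq_empty, Finset.eq_empty_iff_forall_notMem]
  exact fun s hs => this s hs trivial

variable (K) in
/-- The point `[1 : b_1] × ⋯ × [1 : b_k]`. -/
def natPoint (b : Fin k → ℕ) : MPPoint K k (fun _ => 1) := fun i =>
  Projectivization.mk K (fun j => affCoords K b ⟨i, j⟩) fun h => by
    simpa [affCoords] using congrFun h 0

lemma exists_coords_natPoint (b : Fin k → ℕ) (i : Fin k) :
    ∃ a : K, a ≠ 0 ∧ ∀ j, (natPoint K b i).rep j = a * affCoords K b ⟨i, j⟩ := by
  obtain ⟨a, ha⟩ := Projectivization.exists_smul_eq_mk_rep K (fun j => affCoords K b ⟨i, j⟩)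
    fun h => by simpa [affCoords] using congrFun h 0
  exact ⟨a, a.ne_zero, fun j => (congrFun ha j).symm⟩

lemma isWeightedHomogeneous_X_zero (i : Fin k) :
    IsWeightedHomogeneous (wt k fun _ => 1) (X ⟨i, 0⟩ : MPRing K k fun _ => 1) (Pi.single i 1) :=
  isWeightedHomogeneous_X' _

lemma eval_coords_natPoint_ne_zero (b : Fin k → ℕ) (i : Fin k) :
    eval (coords (natPoint K b)) (X ⟨i, 0⟩) ≠ 0 := by
  obtain ⟨a, ha, h⟩ := exists_coords_natPoint (K := K) b i
  rw [eval_X, coords, h]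
  simpa [affCoords] using ha

lemma prior_eq_sup_span_take {n : Fin k → ℕ} (I : Ideal (MPRing K k n))
    (L : Fin k → MPRing K k n) (m : ℕ) :
    I ⊔ Ideal.span {f | f ∈ (List.ofFn L).take m} = prior I L m := by
  rw [prior]
  congr 2
  ext f
  simp only [Set.mem_ofPred_eq, List.mem_take_iff_getElem, List.getElem_ofFn, List.length_ofFn,
    Set.mem_image]
  constructor
  · rintro ⟨i, hi, rfl⟩
    exact ⟨⟨i, by omega⟩, by change i < m; omega, rfl⟩
  · rintro ⟨i, hi, rfl⟩
    exact ⟨i, by have := i.2; have : (i : ℕ) < m := hi; omega, rfl⟩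

section LowerSet

variable [CharZero K] {D : Set (Fin k → ℕ)}

lemma lift_mem_idealOfSet_iff (hD : IsLowerSet D) (p : MPRing K k (fun _ => 1)) :
    lift K k p ∈ idealOfSet K k (fun _ => 1) (natPoint K '' D) ↔ ∀ s ∈ p.support, snd s ∉ D := by
  rw [mem_idealOfSet, Set.forall_mem_image, ← spec_lift_eq_zero_iff hD]
  exact forall₂_congr fun b _ => mem_idealOfPoint_of_smul (exists_coords_natPoint b)

lemma lift_mem_prior_iff (hD : IsLowerSet D) {m : ℕ} (hm : m ≤ k) (p : MPRing K k (fun _ => 1)) :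
    lift K k p ∈ prior (idealOfSet K k (fun _ => 1) (natPoint K '' D)) (fun i => X ⟨i, 0⟩) m ↔
      ∀ s ∈ p.support, snd s ∈ D → ∃ j : Fin k, (j : ℕ) < m ∧ s ⟨j, 0⟩ ≠ 0 := by
  classical
  constructor
  · induction m generalizing p with
    | zero =>
      rw [prior_zero, lift_mem_idealOfSet_iff hD]
      exact fun h s hs hsD => absurd hsD (h s hs)
    | succ m ih =>
      intro h s hs hsD
      have hsucc := prior_succ (I := idealOfSet K k (fun _ => 1) (natPoint K '' D))
        (L := fun i => X ⟨i, 0⟩) ⟨m, hm⟩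
      simp only at hsucc
      rw [hsucc, mem_sup_span_singleton] at h
      obtain ⟨a, ha, b, hab⟩ := h
      obtain ⟨a, rfl⟩ := lift_surjective a
      obtain ⟨b, rfl⟩ := lift_surjective b
      rw [← lift_X_mul, ← map_add] at hab
      rw [lift_injective hab] at hs
      rcases Finset.mem_union.1 (support_add hs) with h1 | h1
      · obtain ⟨j, hj, hj'⟩ := ih (by omega) a ha s h1 hsD
        exact ⟨j, by omega, hj'⟩
      · refine ⟨⟨m, hm⟩, Nat.lt_succ_self m, ?_⟩
        rw [support_X_mul, Finset.mem_map] at h1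
        obtain ⟨t, -, rfl⟩ := h1
        simp
  · intro h
    rw [lift_eq_sum]
    refine Ideal.sum_mem _ fun s hs => ?_
    rw [smul_eq_C_mul]
    refine Ideal.mul_mem_left _ _ ?_
    by_cases hsD : snd s ∈ D
    · obtain ⟨j, hj, hj0⟩ := h s hs hsD
      obtain ⟨t, rfl⟩ : ∃ t, s = Finsupp.single ⟨j, 0⟩ 1 + t :=
        ⟨s - Finsupp.single ⟨j, 0⟩ 1, (add_tsub_cancel_of_le (by
          rw [Finsupp.single_le_iff]; omega)).symm⟩
      rw [fallForm_add_single_zero]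
      exact Ideal.mul_mem_right _ _ (mem_prior (L := fun i : Fin k => X ⟨i, 0⟩) hj)
    · refine le_prior _ ?_
      have := (lift_mem_idealOfSet_iff (K := K) hD (monomial s 1)).2 fun t ht => by
        rw [support_monomial, if_neg one_ne_zero, Finset.mem_singleton] at ht
        rwa [ht]
      rwa [lift_monomial, one_smul] at this

lemma regMod_X (hD : IsLowerSet D) (i : Fin k) :
    RegMod (prior (idealOfSet K k (fun _ => 1) (natPoint K '' D)) (fun i => X ⟨i, 0⟩) i)
      (X ⟨i, 0⟩) := by
  classical
  intro g hg
  obtain ⟨p, rfl⟩ := lift_surjective g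
  rw [← lift_X_mul, lift_mem_prior_iff hD i.2.le] at hg
  rw [lift_mem_prior_iff hD i.2.le]
  intro s hs hsD
  obtain ⟨j, hj, hj0⟩ := hg (Finsupp.single ⟨i, 0⟩ 1 + s)
    (by rw [mem_support_iff, coeff_X_mul]; exact mem_support_iff.1 hs) (by
      convert hsD using 1
      ext l
      simp [snd])
  refine ⟨j, hj, ?_⟩
  have : i ≠ j := by rintro rfl; omega
  simpa [Finsupp.single_apply, this] using hj0

lemma prod_X_mem_prior_iff (hD : IsLowerSet D) (d : Fin k → ℕ) :
    ∏ i, (X ⟨i, 1⟩ : MPRing K k (fun _ => 1)) ^ d i ∈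
      prior (idealOfSet K k (fun _ => 1) (natPoint K '' D)) (fun i => X ⟨i, 0⟩) k ↔ d ∉ D := by
  classical
  set J := prior (idealOfSet K k (fun _ => 1) (natPoint K '' D)) (fun i => X ⟨i, 0⟩) k
  let s : Sig k (fun _ => 1) →₀ ℕ :=
    Finsupp.equivFunOnFinite.symm fun p => if p.2 = 0 then 0 else d p.1
  have hs : snd s = d := by
    ext i
    simp [snd, s]
  have h0 : ∀ i, s ⟨i, 0⟩ = 0 := by simp [s]
  have h1 : Ideal.Quotient.mk J (∏ i, X ⟨i, 1⟩ ^ d i) =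
      Ideal.Quotient.mk J (lift K k (monomial s 1)) := by
    rw [lift_monomial, one_smul, fallForm, map_prod, map_prod]
    refine Finset.prod_congr rfl fun i _ => ?_
    have h2 : Ideal.Quotient.mk J (X ⟨i, 0⟩) = 0 :=
      Ideal.Quotient.eq_zero_iff_mem.2 (mem_prior (L := fun i : Fin k => X ⟨i, 0⟩) i.2)
    have h3 : s ⟨i, 1⟩ = d i := congrFun hs i
    simp [h0, h2, h3, map_prod]
  rw [← Ideal.Quotient.eq_zero_iff_mem, h1, Ideal.Quotient.eq_zero_iff_mem,
    lift_mem_prior_iff hD le_rfl, support_monomial, if_neg one_ne_zero]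
  simp [hs, h0]

lemma delta_hilb_natPoint (hD : IsLowerSet D) (d : Fin k → ℕ) [Decidable (d ∈ D)] :
    delta k (hilb K k (fun _ => 1) (idealOfSet K k (fun _ => 1) (natPoint K '' D))) d =
      if d ∈ D then 1 else 0 := by
  classical
  rw [delta_hilb (isHomogR_idealOfSet _) isWeightedHomogeneous_X_zero (regMod_X hD),
    hilb_eq_ite (fun i => X ⟨i, 1⟩) (fun i => isWeightedHomogeneous_X' _)
      (fun p => if p.2 = 0 then 0 else 1)]
  · rw [prod_X_mem_prior_iff hD]
    split_ifs <;> simp_all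
  · rintro ⟨i, j⟩
    fin_cases j
    · simpa using mem_prior (L := fun i : Fin k => X ⟨i, 0⟩) i.2
    · simp

lemma isACM_natPoint (hD : IsLowerSet D) (hfin : D.Finite) (h0 : 0 ∈ D) :
    IsACM K k (fun _ => 1) (natPoint K '' D) := by
  set I := idealOfSet K k (fun _ => 1) (natPoint K '' D)
  have hI : I ≠ ⊤ := ne_top_of_mem (Set.mem_image_of_mem _ h0)
  have hIm : I ≤ maxIdeal K k (fun _ => 1) := by
    intro f hf
    by_contra hfm
    exact hI ((Ideal.eq_top_iff_one _).2
      ((isHomogR_idealOfSet _).mem_of_mul_mem hfm (by rwa [mul_one])))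
  refine ⟨⟨List.ofFn fun i => X ⟨i, 0⟩, List.length_ofFn, ?_, ?_⟩, ?_⟩
  · refine sup_le hIm (Ideal.span_le.2 ?_)
    intro f hf
    obtain ⟨i, rfl⟩ := List.mem_ofFn.1 hf
    exact X_mem_maxIdeal _
  · intro i G hG
    rw [prior_eq_sup_span_take] at hG ⊢
    rw [List.get_ofFn] at hG
    exact regMod_X hD (Fin.cast List.length_ofFn i) G hG
  · rintro r ⟨L, rfl, hL⟩
    obtain ⟨p, hp, hIp, hdim⟩ := hL.depthGE.exists_prime (u := 1)
      fun s hs => hIm (by rwa [mul_one] at hs)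
    have := ringKrullDim_le (hfin.image _) (fun f hf => hIp f (by rwa [mul_one]))
      isWeightedHomogeneous_X_zero
      (by rintro _ ⟨b, -, rfl⟩ i; exact eval_coords_natPoint_ne_zero b i) (m := 0) (by simp)
    exact_mod_cast hdim.trans this

end LowerSet
end Sufficiency

/-- `H` is the Hilbert function of an ACM set of distinct points of
`ℙ^1 × ⋯ × ℙ^1` (`k` times) iff `ΔH` satisfies conditions (i)–(iv). -/
theorem statement_10 (K : Type) [Field K] [IsAlgClosed K] [CharZero K]
    (k : ℕ) (hk : 0 < k) (H : (Fin k → ℕ) → ℕ) :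
    (∃ X : Set (MPPoint K k (fun _ => 1)), X.Finite ∧ IsACM K k (fun _ => 1) X ∧
        ∀ d : Fin k → ℕ, hilb K k (fun _ => 1) (idealOfSet K k (fun _ => 1) X) d = H d) ↔
    (delta k H 0 = 1 ∧
      (∀ d : Fin k → ℕ, d ≠ 0 → delta k H d = 0 ∨ delta k H d = 1) ∧
      (∀ d : Fin k → ℕ, delta k H d = 0 → ∀ j : Fin k → ℕ, d ≤ j → delta k H j = 0) ∧
      (∀ i : Fin k, ∃ t : ℕ, delta k H (Pi.single i t) = 0)) := by
  classical
  constructor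
  · rintro ⟨S, hS, hACM, hH⟩
    exact delta_of_isACM hS hACM (funext hH)
  · rintro ⟨h0, h01, hup, hax⟩
    let D : Set (Fin k → ℕ) := {d | delta k H d ≠ 0}
    have hD : IsLowerSet D := fun a b hba ha hb => ha (hup b hb a hba)
    choose t ht using hax
    have hfin : D.Finite := by
      refine (Set.finite_Iic t).subset fun d hd i => ?_
      by_contra! hlt
      refine hd (hup _ (ht i) d fun j => ?_)
      rcases eq_or_ne j i with rfl | hj
      · simpa using hlt.le
      · simp [hj]
    refine ⟨natPoint K '' D, hfin.image _,
      isACM_natPoint hD hfin (by simp [D, h0]), congrFun (delta_injective ?_)⟩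
    funext d
    rw [delta_hilb_natPoint hD]
    split_ifs with hd
    · rcases eq_or_ne d 0 with rfl | hd0
      · exact h0.symm
      · exact ((h01 d hd0).resolve_left hd).symm
    · exact (not_not.1 hd).symm

end PaperMP
end
end

section
/- Let X ⊆ ℙ^1 × ℙ^1 be a finite set of distinct points, let t = |π_1(X)| and r = |π_2(X)|, and set c_{i,j} = ΔH_X(i,j). Then: (i) for every 0 ≤ j ≤ r − 1, the (j+1)-th entry of the conjugate partition α_X* equals Σ_{h ≤ t−1} c_{h,j}; and (ii) for every 0 ≤ i ≤ t − 1, the (i+1)-th entry of the conjugate partition β_X* equals Σ_{h ≤ r−1} c_{i,h}. -/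
open MvPolynomial

noncomputable section

namespace PaperMP

open Module

/-! ### Points of the projective line and homogeneous Vandermonde matrices -/

section ProjectiveLine

variable {K : Type} [Field K]

/-- The value at the chosen representative of `p` of the monomial `x_0 ^ a * x_1 ^ (d - a)`. -/
def monomialValue (d a : ℕ) (p : Proj1 K) : K :=
  p.rep 0 ^ a * p.rep 1 ^ (d - a)

theorem eq_of_rep_mul_eq {p q : Proj1 K} (h : q.rep 0 * p.rep 1 = p.rep 0 * q.rep 1) :
    p = q := by
  rw [← p.mk_rep, ← q.mk_rep, Projectivization.mk_eq_mk_iff']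
  have hq := q.rep_nonzero
  by_cases h0 : q.rep 0 = 0
  · have h1 : q.rep 1 ≠ 0 := fun h1 => hq (by ext i; fin_cases i <;> simp [h0, h1])
    refine ⟨p.rep 1 / q.rep 1, ?_⟩
    have hp : p.rep 0 = 0 := by
      have : p.rep 0 * q.rep 1 = 0 := by rw [← h, h0, zero_mul]
      exact (mul_eq_zero.mp this).resolve_right h1
    ext i; fin_cases i
    · simp [h0, hp]
    · simp [h1]
  · refine ⟨p.rep 0 / q.rep 0, ?_⟩
    ext i; fin_cases i
    · simp [h0]
    · simp only [Pi.smul_apply, smul_eq_mul, Fin.mk_one]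
      rw [div_mul_eq_mul_div, div_eq_iff h0, ← h, mul_comm]

instance [Infinite K] : Infinite (Proj1 K) := by
  refine Infinite.of_injective
    (fun c : K => Projectivization.mk K ![1, c] (fun h => by simpa using congrFun h 0)) ?_
  intro a b hab
  obtain ⟨c, hc⟩ := (Projectivization.mk_eq_mk_iff' K _ _ _ _).mp hab
  have h0 : c = 1 := by simpa using congrFun hc 0
  have h1 := congrFun hc 1
  simpa [h0, eq_comm] using h1

theorem span_monomialValue_eq_top_of_fin {d : ℕ} {B : Fin (d + 1) → Proj1 K}
    (hB : Function.Injective B) :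
    Submodule.span K (Set.range fun (b : Fin (d + 1)) e => monomialValue d b (B e)) = ⊤ := by
  set M := Matrix.projVandermonde (fun e => (B e).rep 0) (fun e => (B e).rep 1) with hM
  have hdet : M.det ≠ 0 := by
    rw [hM, Matrix.det_projVandermonde]
    refine Finset.prod_ne_zero_iff.mpr fun i _ => Finset.prod_ne_zero_iff.mpr fun j hj => ?_
    intro h
    have := hB (eq_of_rep_mul_eq (sub_eq_zero.mp h))
    exact (Finset.mem_Ioi.mp hj).ne this
  have hcol : M.col = fun (b : Fin (d + 1)) e => monomialValue d b (B e) := by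
    ext b e
    simp only [Matrix.col_apply, hM, Matrix.projVandermonde_apply, monomialValue, Fin.val_rev]
    congr 2
    omega
  have hli : LinearIndependent K M.col :=
    Matrix.linearIndependent_cols_iff_isUnit.mpr
      ((Matrix.isUnit_iff_isUnit_det _).mpr (isUnit_iff_ne_zero.mpr hdet))
  rw [← hcol]
  exact hli.span_eq_top_of_card_eq_finrank (by simp)

theorem map_funLeft_span_monomialValue {E F : Type*} (B : F → Proj1 K) (f : E → F) (d : ℕ) :
    (Submodule.span K (Set.range fun (b : Fin (d + 1)) e => monomialValue d b (B e))).map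
      (LinearMap.funLeft K K f) =
    Submodule.span K (Set.range fun (b : Fin (d + 1)) e => monomialValue d b (B (f e))) := by
  rw [Submodule.map_span, ← Set.range_comp]
  rfl

/-- Forms of degree `d` on the projective line separate up to `d + 1` points. -/
theorem span_monomialValue_eq_top [Infinite K] {E : Type*} [Fintype E] {d : ℕ}
    {B : E → Proj1 K} (hB : Function.Injective B) (hE : Fintype.card E ≤ d + 1) :
    Submodule.span K (Set.range fun (b : Fin (d + 1)) e => monomialValue d b (B e)) = ⊤ := by
  classical
  obtain ⟨T, hT, hcard⟩ := Infinite.exists_superset_card_eq (Finset.univ.image B) (d + 1)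
    (Finset.card_image_le.trans hE)
  have hmem (e : E) : B e ∈ T := hT (Finset.mem_image_of_mem _ (Finset.mem_univ e))
  let φ := T.equivFinOfCardEq hcard
  let f : E → Fin (d + 1) := fun e => φ ⟨B e, hmem e⟩
  have hf : Function.Injective f := fun a b hab =>
    hB (congrArg Subtype.val (φ.injective hab))
  have hBf : B = fun e => ((φ.symm (f e) : T) : Proj1 K) := by
    ext1 e; simp [f]
  have h := map_funLeft_span_monomialValue (fun i => ((φ.symm i : T) : Proj1 K)) f d
  rw [span_monomialValue_eq_top_of_fin (B := fun i => ((φ.symm i : T) : Proj1 K))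
    (Subtype.val_injective.comp φ.symm.injective), Submodule.map_top,
    LinearMap.range_eq_top.mpr (LinearMap.funLeft_surjective_of_injective K K f hf)] at h
  rw [hBf]
  exact h.symm

/-- The Hilbert function of a finite set of points on the projective line. -/
theorem finrank_span_monomialValue [Infinite K] {E : Type*} [Fintype E] (d : ℕ)
    {B : E → Proj1 K} (hB : Function.Injective B) :
    finrank K (Submodule.span K
      (Set.range fun (b : Fin (d + 1)) e => monomialValue d b (B e))) =
      min (d + 1) (Fintype.card E) := by
  rcases le_total (Fintype.card E) (d + 1) with h | h
  · rw [span_monomialValue_eq_top hB h, finrank_top, finrank_fintype_fun_eq_card, min_eq_right h]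
  · rw [min_eq_left h]
    refine le_antisymm ((finrank_range_le_card _).trans (by simp)) ?_
    obtain ⟨f⟩ := Function.Embedding.nonempty_of_card_le
      (α := Fin (d + 1)) (β := E) (by simpa using h)
    have h2 := map_funLeft_span_monomialValue B f d
    rw [span_monomialValue_eq_top_of_fin (B := fun i => B (f i)) (hB.comp f.injective)] at h2
    have h3 := Submodule.finrank_map_le (LinearMap.funLeft K K f) (Submodule.span K
      (Set.range fun (b : Fin (d + 1)) e => monomialValue d b (B e)))
    rw [h2] at h3
    simpa using h3

end ProjectiveLine

/-! ### Spans of products of functions -/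

/-- If the functions `u a` span `I → K`, then the span of the products `u a (π e) * v b e` is the
direct sum, over the fibers of `π`, of the spans of the restrictions of the `v b`. -/
theorem finrank_span_mul_comp {K : Type*} [Field K] {E I A B : Type*} [Fintype I]
    [Finite E] (π : E → I) (u : A → I → K) (v : B → E → K)
    (hu : Submodule.span K (Set.range u) = ⊤) :
    finrank K (Submodule.span K
      (Set.range fun (ab : A × B) e => u ab.1 (π e) * v ab.2 e)) =
    ∑ i, finrank K (Submodule.span K (Set.range fun b (e : {e // π e = i}) => v b e)) := by
  classical
  set W := Submodule.span K (Set.range fun (ab : A × B) e => u ab.1 (π e) * v ab.2 e)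
  let S (i : I) : Submodule K ({e // π e = i} → K) :=
    Submodule.span K (Set.range fun b (e : {e // π e = i}) => v b e)
  let Φ : (∀ i, S i) →ₗ[K] (E → K) :=
    { toFun := fun w e => (w (π e)).1 ⟨e, rfl⟩
      map_add' := fun _ _ => rfl
      map_smul' := fun _ _ => rfl }
  have hΦ : Function.Injective Φ := by
    intro w w' h
    ext i ⟨e, rfl⟩
    exact congrFun h e
  have hmul (φ : I → K) (b : B) : (fun e => φ (π e) * v b e) ∈ W := by
    let T : (I → K) →ₗ[K] (E → K) :=
      { toFun := fun φ e => φ (π e) * v b e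
        map_add' := fun _ _ => by ext; simp [add_mul]
        map_smul' := fun _ _ => by ext; simp [mul_assoc] }
    have : Submodule.span K (Set.range u) ≤ W.comap T := by
      rw [Submodule.span_le]
      rintro _ ⟨a, rfl⟩
      exact Submodule.subset_span ⟨(a, b), rfl⟩
    exact this (hu ▸ Submodule.mem_top : φ ∈ _)
  have hsingle (i : I) (s : S i) : Φ (Pi.single i s) ∈ W := by
    let T : S i →ₗ[K] (E → K) := Φ ∘ₗ LinearMap.single K (fun i => S i) i
    let J : ({e // π e = i} → K) →ₗ[K] (E → K) :=
      { toFun := fun f e => if h : π e = i then f ⟨e, h⟩ else 0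
        map_add' := fun _ _ => by ext e; by_cases h : π e = i <;> simp [h]
        map_smul' := fun _ _ => by ext e; by_cases h : π e = i <;> simp [h] }
    have hJ : Φ (Pi.single i s) = J s := by
      ext e
      by_cases h : π e = i
      · subst h; simp [Φ, J]
      · simp [Φ, J, h]
    rw [hJ]
    have : S i ≤ W.comap J := by
      refine Submodule.span_le.mpr ?_
      rintro _ ⟨b, rfl⟩
      have heq : J (fun e => v b e) = fun e => (Pi.single i 1 : I → K) (π e) * v b e := by
        ext e
        by_cases h : π e = i
        · subst h; simp [J]
        · simp [J, h]
      exact Set.mem_of_eq_of_mem (s := W) heq (hmul (Pi.single i 1) b)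
    exact this s.2
  have hrange : LinearMap.range Φ = W := by
    apply le_antisymm
    · rintro _ ⟨w, rfl⟩
      rw [← Finset.univ_sum_single w, map_sum]
      exact Submodule.sum_mem _ fun i _ => hsingle i _
    · refine Submodule.span_le.mpr ?_
      rintro _ ⟨⟨a, b⟩, rfl⟩
      exact ⟨fun i => u a i • ⟨_, Submodule.subset_span ⟨b, rfl⟩⟩, rfl⟩
  rw [← hrange, LinearMap.finrank_range_of_inj hΦ, finrank_pi_fintype]

/-- For points `(A e, B e)` of `ℙ¹ × ℙ¹` whose first coordinates are `P_0, …, P_s`, the forms of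
bidegree `(s, d)` impose independently `min (d + 1) α_i` conditions on each fiber. -/
theorem finrank_span_monomialValue_mul {K : Type} [Field K] [Infinite K] {E : Type*} [Finite E]
    (A B : E → Proj1 K) (hAB : ∀ e e', A e = A e' → B e = B e' → e = e') {s : ℕ}
    (P : Fin (s + 1) → Proj1 K) (hP : Function.Injective P) (hA : ∀ e, ∃ i, P i = A e) (d : ℕ) :
    finrank K (Submodule.span K (Set.range fun (ab : Fin (s + 1) × Fin (d + 1)) e =>
      monomialValue s ab.1 (A e) * monomialValue d ab.2 (B e))) =
    ∑ i, min (d + 1) (Nat.card {e // A e = P i}) := by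
  classical
  have := Fintype.ofFinite E
  choose π hπ using hA
  have h := finrank_span_mul_comp π (fun (a : Fin (s + 1)) i => monomialValue s a (P i))
    (fun (b : Fin (d + 1)) e => monomialValue d b (B e)) (span_monomialValue_eq_top_of_fin hP)
  obtain rfl : A = fun e => P (π e) := (_root_.funext hπ).symm
  rw [h]
  refine Finset.sum_congr rfl fun i _ => ?_
  have hinj : Function.Injective fun e : {e // π e = i} => B e := by
    rintro ⟨e, rfl⟩ ⟨e', he'⟩ hB
    exact Subtype.ext (hAB _ _ (congrArg P he'.symm) hB)
  rw [finrank_span_monomialValue d hinj, ← Nat.card_eq_fintype_card]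
  congr 1
  refine Nat.card_congr (Equiv.subtypeEquivRight fun e => ?_)
  exact hP.eq_iff.symm

/-! ### The Hilbert function as the rank of an evaluation map -/

section Evaluation

variable {K : Type} [Field K]

/-- The chosen representative of a point of multiprojective space. -/
def repPoint {k : ℕ} {n : Fin k → ℕ} (P : MPPoint K k n) : Sig k n → K :=
  fun p => (P p.1).rep p.2

theorem weight_wt {k : ℕ} {n : Fin k → ℕ} (s : Sig k n →₀ ℕ) (i : Fin k) :
    Finsupp.weight (wt k n) s i = ∑ j, s ⟨i, j⟩ := by
  rw [Finsupp.weight_eq_sum, Finset.sum_apply, Fintype.sum_sigma, Finset.sum_eq_single i]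
  · simp [wt]
  · intro i' _ h
    simp [wt, Pi.single_eq_of_ne h.symm]
  · simp

theorem eval_scale_of_mem {k : ℕ} {n : Fin k → ℕ} {d : Fin k → ℕ} {f : MPRing K k n}
    (hf : f ∈ weightedHomogeneousSubmodule K (wt k n) d) (c : Fin k → K) (x : Sig k n → K) :
    eval (fun p => c p.1 * x p) f = (∏ i, c i ^ d i) * eval x f := by
  rw [eval_eq', eval_eq', Finset.mul_sum]
  refine Finset.sum_congr rfl fun s hs => ?_
  have hw : Finsupp.weight (wt k n) s = d := hf (mem_support_iff.mp hs)
  have hc : ∏ p : Sig k n, c p.1 ^ s p = ∏ i, c i ^ d i := by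
    rw [Fintype.prod_sigma]
    refine Finset.prod_congr rfl fun i _ => ?_
    rw [← hw, weight_wt]
    exact Finset.prod_pow_eq_pow_sum Finset.univ (fun j => s ⟨i, j⟩) (c i)
  simp only [mul_pow, Finset.prod_mul_distrib, hc]
  ring

theorem mem_idealOfSet_iff {k : ℕ} {n : Fin k → ℕ} {d : Fin k → ℕ} {f : MPRing K k n}
    (hf : f ∈ weightedHomogeneousSubmodule K (wt k n) d) (X : Set (MPPoint K k n)) :
    f ∈ idealOfSet K k n X ↔ ∀ P ∈ X, eval (repPoint P) f = 0 := by
  simp only [idealOfSet, idealOfPoint, vanishingIdeal, Ideal.mem_iInf, RingHom.mem_ker]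
  refine forall₂_congr fun P _ => ⟨fun h => h _ fun i => ⟨1, (one_smul _ _).symm⟩, ?_⟩
  intro h x hx
  choose c hc using hx
  have hx' : x = fun p => c p.1 * repPoint P p := by
    ext ⟨i, j⟩
    exact congrFun (hc i) j
  rw [hx', eval_scale_of_mem hf, h, mul_zero]

/-- Evaluation of polynomials at the chosen representatives of the points of `X`. -/
def evalAt {k : ℕ} {n : Fin k → ℕ} (X : Set (MPPoint K k n)) : MPRing K k n →ₗ[K] (X → K) :=
  LinearMap.pi fun Z => (aeval (repPoint Z.1)).toLinearMap

theorem evalAt_apply {k : ℕ} {n : Fin k → ℕ} (X : Set (MPPoint K k n)) (f : MPRing K k n)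
    (Z : X) : evalAt X f Z = eval (repPoint Z.1) f := rfl

theorem finrank_map_eq_of_ker {V W W' : Type*} [AddCommGroup V] [Module K V] [AddCommGroup W]
    [Module K W] [AddCommGroup W'] [Module K W'] (S : Submodule K V) (f : V →ₗ[K] W)
    (g : V →ₗ[K] W') (h : ∀ v ∈ S, f v = 0 ↔ g v = 0) :
    finrank K (S.map f) = finrank K (S.map g) := by
  have hker : LinearMap.ker (f ∘ₗ S.subtype) = LinearMap.ker (g ∘ₗ S.subtype) := by
    ext v
    exact h v v.2
  rw [← S.range_subtype, ← LinearMap.range_comp, ← LinearMap.range_comp]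
  exact ((LinearMap.quotKerEquivRange _).symm.trans
    ((Submodule.quotEquivOfEq _ _ hker).trans (LinearMap.quotKerEquivRange _))).finrank_eq

theorem hilb_idealOfSet {k : ℕ} {n : Fin k → ℕ} (X : Set (MPPoint K k n)) (d : Fin k → ℕ) :
    hilb K k n (idealOfSet K k n X) d =
      finrank K ((weightedHomogeneousSubmodule K (wt k n) d).map (evalAt X)) := by
  refine finrank_map_eq_of_ker _ _ _ fun f hf => ?_
  rw [AlgHom.toLinearMap_apply, Ideal.Quotient.mkₐ_eq_mk, Ideal.Quotient.eq_zero_iff_mem,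
    mem_idealOfSet_iff hf, _root_.funext_iff, Subtype.forall]
  rfl

theorem weightedHomogeneousSubmodule_eq_span {σ M : Type*} [AddCommMonoid M] (w : σ → M) (d : M) :
    weightedHomogeneousSubmodule K w d =
      Submodule.span K ((fun s => monomial s 1) '' {s | Finsupp.weight w s = d}) := by
  apply le_antisymm
  · intro f hf
    rw [f.as_sum]
    refine Submodule.sum_mem _ fun s hs => ?_
    rw [← mul_one (coeff s f), ← smul_eq_mul, ← smul_monomial]
    exact Submodule.smul_mem _ _
      (Submodule.subset_span ⟨s, hf (mem_support_iff.mp hs), rfl⟩)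
  · refine Submodule.span_le.mpr ?_
    rintro _ ⟨s, hs, rfl⟩
    exact isWeightedHomogeneous_monomial _ _ _ hs

theorem hilb_eq_finrank_span (X : Set (Pt2 K)) (a b : ℕ) :
    hilb K 2 (fun _ => 1) (idealOfSet K 2 (fun _ => 1) X) ![a, b] =
      finrank K (Submodule.span K (Set.range fun (ij : Fin (a + 1) × Fin (b + 1)) (Z : X) =>
        monomialValue a ij.1 (Z.1 0) * monomialValue b ij.2 (Z.1 1))) := by
  have heval (s : Sig 2 (fun _ => 1) →₀ ℕ) (Z : X) : evalAt X (monomial s 1) Z =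
      (Z.1 0).rep 0 ^ s ⟨0, 0⟩ * (Z.1 0).rep 1 ^ s ⟨0, 1⟩ *
      ((Z.1 1).rep 0 ^ s ⟨1, 0⟩ * (Z.1 1).rep 1 ^ s ⟨1, 1⟩) := by
    rw [evalAt_apply, eval_monomial, one_mul, Finsupp.prod_fintype _ _ (by simp),
      Fintype.prod_sigma]
    simp only [Fin.prod_univ_two, repPoint]
    exact congrArg₂ _ (Fin.prod_univ_two _) (Fin.prod_univ_two _)
  have hweight (s : Sig 2 (fun _ => 1) →₀ ℕ) : Finsupp.weight (wt 2 fun _ => 1) s = ![a, b] ↔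
      s ⟨0, 0⟩ + s ⟨0, 1⟩ = a ∧ s ⟨1, 0⟩ + s ⟨1, 1⟩ = b := by
    rw [_root_.funext_iff]
    simp only [weight_wt, Fin.forall_fin_two]
    rfl
  rw [hilb_idealOfSet, weightedHomogeneousSubmodule_eq_span, Submodule.map_span, Set.image_image]
  refine congrArg (fun S : Set (X → K) => finrank K (Submodule.span K S)) (Set.ext fun g => ?_)
  constructor
  · rintro ⟨s, hs, rfl⟩
    obtain ⟨h0, h1⟩ := (hweight s).mp hs
    refine ⟨⟨⟨s ⟨0, 0⟩, by omega⟩, ⟨s ⟨1, 0⟩, by omega⟩⟩, ?_⟩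
    ext Z
    refine Eq.trans ?_ (heval s Z).symm
    simp only [monomialValue, ← h0, ← h1, Nat.add_sub_cancel_left]
  · rintro ⟨⟨i, j⟩, rfl⟩
    let s : Sig 2 (fun _ => 1) →₀ ℕ := Finsupp.equivFunOnFinite.symm fun p =>
      ![![(i : ℕ), a - i], ![(j : ℕ), b - j]] p.1 p.2
    refine ⟨s, (hweight s).mpr ?_, ?_⟩
    · simp [s]
      omega
    · ext Z
      refine (heval s Z).trans ?_
      simp [s, monomialValue]

end Evaluation

/-! ### Difference functions and conjugate partitions -/

theorem delta_two (H : (Fin 2 → ℕ) → ℕ) (a b : ℕ) :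
    delta 2 H ![a, b] =
      extNeg 2 H ![a, b] - extNeg 2 H ![(a : ℤ) - 1, b] -
        (extNeg 2 H ![a, (b : ℤ) - 1] - extNeg 2 H ![(a : ℤ) - 1, (b : ℤ) - 1]) := by
  have h (l : Fin 2 → Fin 2) : (fun i => ((![a, b] i : ℕ) : ℤ) - (l i : ℕ)) =
      ![(a : ℤ) - (l 0 : ℕ), (b : ℤ) - (l 1 : ℕ)] := by
    ext i; fin_cases i <;> rfl
  simp only [delta, h, Fin.sum_univ_two]
  rw [← (finTwoArrowEquiv (Fin 2)).symm.sum_comp, Fintype.sum_prod_type]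
  simp [Fin.sum_univ_two]
  ring

theorem extNeg_natCast (H : (Fin 2 → ℕ) → ℕ) (a b : ℕ) :
    extNeg 2 H ![(a : ℤ), (b : ℤ)] = H ![a, b] := by
  rw [extNeg, if_pos (by simp [Fin.forall_fin_two])]
  congr 2
  ext i; fin_cases i <;> rfl

theorem extNeg_of_left_neg (H : (Fin 2 → ℕ) → ℕ) {a : ℤ} (b : ℤ) (ha : a < 0) :
    extNeg 2 H ![a, b] = 0 :=
  if_neg fun h => (not_le_of_gt ha) (h 0)

theorem extNeg_of_right_neg (H : (Fin 2 → ℕ) → ℕ) (a : ℤ) {b : ℤ} (hb : b < 0) :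
    extNeg 2 H ![a, b] = 0 :=
  if_neg fun h => (not_le_of_gt hb) (h 1)

theorem sum_delta_left (H : (Fin 2 → ℕ) → ℕ) (t j : ℕ) :
    ∑ h ∈ Finset.range t, delta 2 H ![h, j] =
      extNeg 2 H ![(t : ℤ) - 1, j] - extNeg 2 H ![(t : ℤ) - 1, (j : ℤ) - 1] := by
  induction t with
  | zero => simp [extNeg_of_left_neg]
  | succ t ih =>
    rw [Finset.sum_range_succ, ih, delta_two]
    push_cast
    rw [add_sub_cancel_right]
    ring

theorem sum_delta_right (H : (Fin 2 → ℕ) → ℕ) (r i : ℕ) :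
    ∑ h ∈ Finset.range r, delta 2 H ![i, h] =
      extNeg 2 H ![(i : ℤ), (r : ℤ) - 1] - extNeg 2 H ![(i : ℤ) - 1, (r : ℤ) - 1] := by
  induction r with
  | zero => simp [extNeg_of_right_neg]
  | succ r ih =>
    rw [Finset.sum_range_succ, ih, delta_two]
    push_cast
    rw [add_sub_cancel_right]
    ring

theorem conjEntry_add_sum_min {t : ℕ} (lam : Fin t → ℕ) (j : ℕ) :
    conjEntry lam j + ∑ i, min j (lam i) = ∑ i, min (j + 1) (lam i) := by
  rw [conjEntry, Finset.card_filter, ← Finset.sum_add_distrib]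
  refine Finset.sum_congr rfl fun i _ => ?_
  split_ifs <;> omega

theorem conjEntry_eq_sub {t : ℕ} (lam : Fin t → ℕ) (G : ℤ → ℤ) (hneg : G (-1) = 0)
    (hG : ∀ j : ℕ, G j = ∑ i, min (j + 1) (lam i)) (j : ℕ) :
    (conjEntry lam j : ℤ) = G j - G (j - 1) := by
  have h := conjEntry_add_sum_min lam j
  have hG' : G (j - 1) = ((∑ i, min j (lam i) : ℕ) : ℤ) := by
    cases j with
    | zero => simpa using hneg
    | succ j => simpa using hG j
  rw [hG, hG', ← h]
  push_cast
  ring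

theorem hilb_eq_sum_min_fst {K : Type} [Field K] [Infinite K] {X : Set (Pt2 K)} (hX : X.Finite)
    {s : ℕ} {P : Fin (s + 1) → Proj1 K} {α : Fin (s + 1) → ℕ} (hα : IsAlphaLabel K X P α)
    (d : ℕ) :
    hilb K 2 (fun _ => 1) (idealOfSet K 2 (fun _ => 1) X) ![s, d] =
      ∑ i, min (d + 1) (α i) := by
  have := hX.to_subtype
  obtain ⟨hP, hrange, hcard, -⟩ := hα
  rw [hilb_eq_finrank_span, finrank_span_monomialValue_mul (fun Z : X => Z.1 0) (fun Z => Z.1 1)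
    (fun Z Z' h0 h1 => Subtype.ext (_root_.funext (Fin.forall_fin_two.mpr ⟨h0, h1⟩))) P hP
    (fun Z => hrange.ge ⟨Z.1, Z.2, rfl⟩)]
  refine Finset.sum_congr rfl fun i _ => ?_
  rw [hcard, ← Nat.card_coe_set_eq]
  congr 1
  exact Nat.card_congr (Equiv.subtypeSubtypeEquivSubtypeInter (· ∈ X) (fun Z => Z 0 = P i))

theorem hilb_eq_sum_min_snd {K : Type} [Field K] [Infinite K] {X : Set (Pt2 K)} (hX : X.Finite)
    {s : ℕ} {Q : Fin (s + 1) → Proj1 K} {β : Fin (s + 1) → ℕ} (hβ : IsBetaLabel K X Q β)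
    (d : ℕ) :
    hilb K 2 (fun _ => 1) (idealOfSet K 2 (fun _ => 1) X) ![d, s] =
      ∑ i, min (d + 1) (β i) := by
  have := hX.to_subtype
  obtain ⟨hQ, hrange, hcard, -⟩ := hβ
  have hswap : (Set.range fun (ij : Fin (d + 1) × Fin (s + 1)) (Z : X) =>
        monomialValue d ij.1 (Z.1 0) * monomialValue s ij.2 (Z.1 1)) =
      Set.range fun (ij : Fin (s + 1) × Fin (d + 1)) (Z : X) =>
        monomialValue s ij.1 (Z.1 1) * monomialValue d ij.2 (Z.1 0) := by
    rw [← (Equiv.prodComm (Fin (s + 1)) (Fin (d + 1))).surjective.range_comp]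
    simp only [Function.comp_def, Equiv.prodComm_apply, Prod.fst_swap, Prod.snd_swap, mul_comm]
  rw [hilb_eq_finrank_span, hswap,
    finrank_span_monomialValue_mul (fun Z : X => Z.1 1) (fun Z => Z.1 0)
    (fun Z Z' h1 h0 => Subtype.ext (_root_.funext (Fin.forall_fin_two.mpr ⟨h0, h1⟩))) Q hQ
    (fun Z => hrange.ge ⟨Z.1, Z.2, rfl⟩)]
  refine Finset.sum_congr rfl fun i _ => ?_
  rw [hcard, ← Nat.card_coe_set_eq]
  congr 1
  exact Nat.card_congr (Equiv.subtypeSubtypeEquivSubtypeInter (· ∈ X) (fun Z => Z 1 = Q i))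


/-- the entries of the conjugates `α_X*` and `β_X*` are the column sums
and row sums of the first difference function `ΔH_X`. -/
theorem statement_12 (K : Type) [Field K] [IsAlgClosed K] [CharZero K]
    (X : Set (Pt2 K)) (hX : X.Finite)
    (t r : ℕ) (P : Fin t → Proj1 K) (Q : Fin r → Proj1 K)
    (α : Fin t → ℕ) (β : Fin r → ℕ)
    (hα : IsAlphaLabel K X P α) (hβ : IsBetaLabel K X Q β) :
    (∀ j : ℕ, j < r → (conjEntry α j : ℤ) =
      ∑ h ∈ Finset.range t,
        delta 2 (hilb K 2 (fun _ => 1) (idealOfSet K 2 (fun _ => 1) X)) ![h, j]) ∧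
    (∀ i : ℕ, i < t → (conjEntry β i : ℤ) =
      ∑ h ∈ Finset.range r,
        delta 2 (hilb K 2 (fun _ => 1) (idealOfSet K 2 (fun _ => 1) X)) ![i, h]) := by
  have hXt (t r : ℕ) (A : Fin t → Proj1 K) (B : Fin r → Proj1 K) (a b : Fin 2)
      (hA : Set.range A = (fun Z : Pt2 K => Z a) '' X)
      (hB : Set.range B = (fun Z : Pt2 K => Z b) '' X) (hr : 0 < r) : 0 < t := by
    obtain ⟨Z, hZ, -⟩ := hB.le ⟨⟨0, hr⟩, rfl⟩
    obtain ⟨i, -⟩ := hA.ge ⟨Z, hZ, rfl⟩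
    exact i.pos
  constructor
  · intro j hj
    obtain ⟨s, rfl⟩ := Nat.exists_eq_add_one.mpr
      (hXt t r P Q 0 1 hα.2.1 hβ.2.1 (j.zero_le.trans_lt hj))
    rw [sum_delta_left]
    push_cast
    rw [add_sub_cancel_right]
    exact conjEntry_eq_sub α (fun y => extNeg 2 _ ![(s : ℤ), y])
      (extNeg_of_right_neg _ _ (by simp))
      (fun d => by rw [extNeg_natCast, hilb_eq_sum_min_fst hX hα]) j
  · intro i hi
    obtain ⟨s, rfl⟩ := Nat.exists_eq_add_one.mpr
      (hXt r t Q P 1 0 hβ.2.1 hα.2.1 (i.zero_le.trans_lt hi))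
    rw [sum_delta_right]
    push_cast
    rw [add_sub_cancel_right]
    exact conjEntry_eq_sub β (fun y => extNeg 2 _ ![y, (s : ℤ)])
      (extNeg_of_left_neg _ _ (by simp))
      (fun d => by rw [extNeg_natCast, hilb_eq_sum_min_snd hX hβ]) i

end PaperMP
end
end

section
/- Let X ⊆ ℙ^1 × ℙ^1 be a finite set of distinct points, and suppose α_X* = β_X. Let P be a point of π_1(X) such that the fiber X_P := π_1^{-1}(P) ∩ X has |X_P| = α_1, the largest part of α_X. Then π_2(X_P) = π_2(X). -/
open MvPolynomial

noncomputable section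

namespace PaperMP

/-- The second projection is injective on the fibers of the first projection. -/
theorem injOn_snd_fiber (K : Type) [Field K] (X : Set (Pt2 K)) (P : Proj1 K) :
    Set.InjOn (fun Z : Pt2 K => Z 1) {Z | Z ∈ X ∧ Z 0 = P} := by
  rintro Z ⟨-, hZ⟩ W ⟨-, hW⟩ h
  funext i
  fin_cases i
  · exact hZ.trans hW.symm
  · exact h

/-- The number of parts of `α*` is at most the largest part of `α`, provided that all parts of
`α*` are positive. -/
theorem IsConjugateOf.length_le {t r : ℕ} {α : Fin t → ℕ} {β : Fin r → ℕ}
    (h : IsConjugateOf α β) (hα : Antitone α) (ht : 0 < t) (hβ : ∀ i, 0 < β i) :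
    r ≤ α ⟨0, ht⟩ := by
  rcases r with - | r
  · exact Nat.zero_le _
  have hpos := hβ (Fin.last r)
  rw [h.1, conjEntry, Finset.card_pos] at hpos
  obtain ⟨j, hj⟩ := hpos
  exact (Finset.mem_filter.mp hj).2.trans (hα (Fin.mk_le_of_le_val (Nat.zero_le _)))

/-- if `α_X* = β_X` and `P ∈ π_1(X)` has fiber of size `α_1`, then
`π_2(X_P) = π_2(X)`. -/
theorem statement_13 (K : Type) [Field K] [IsAlgClosed K] [CharZero K]
    (X : Set (Pt2 K)) (hX : X.Finite)
    (t r : ℕ) (ht : 0 < t) (α : Fin t → ℕ) (β : Fin r → ℕ)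
    (hα : IsAlphaPartition K X α) (hβ : IsBetaPartition K X β)
    (hconj : IsConjugateOf α β)
    (P : Proj1 K) (hP : P ∈ (fun Z : Pt2 K => Z 0) '' X)
    (hfib : Set.ncard {Z | Z ∈ X ∧ Z 0 = P} = α ⟨0, ht⟩) :
    (fun Z : Pt2 K => Z 1) '' {Z | Z ∈ X ∧ Z 0 = P} = (fun Z : Pt2 K => Z 1) '' X := by
  obtain ⟨_, -, -, -, hanti⟩ := hα
  obtain ⟨Q, hQ, hrange, hcard, -⟩ := hβ
  have hβpos : ∀ i, 0 < β i := by
    intro i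
    obtain ⟨Z, hZ, hZi⟩ : Q i ∈ (fun Z : Pt2 K => Z 1) '' X := hrange ▸ Set.mem_range_self i
    rw [hcard, Set.ncard_pos (hX.subset fun _ h => h.1)]
    exact ⟨Z, hZ, hZi⟩
  refine Set.eq_of_subset_of_ncard_le (Set.image_mono fun _ h => h.1) ?_ (hX.image _)
  calc ((fun Z : Pt2 K => Z 1) '' X).ncard = (Set.range Q).ncard := by rw [hrange]
    _ = r := by rw [Set.ncard_range_of_injective hQ, Nat.card_fin]
    _ ≤ α ⟨0, ht⟩ := hconj.length_le hanti ht hβpos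
    _ = _ := by rw [(injOn_snd_fiber K X P).ncard_image, hfib]

end PaperMP
end
end
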